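/- arXiv:2012.09271 — 10 statements merged into one kernel-verified Lean document; each statement's English description precedes it below -/
import Mathlib

section
/- (Alon–Chung) Let X be a finite simple s-regular graph with spectral bound λ₂ (0 ≤ λ₂ < s). Let S ⊆ V(X) and set γ = |S|/|V(X)|. Then the number of edges of X having both endpoints in S is at most (γ² + (λ₂/s)·γ·(1−γ))·|E(X)|. -/
namespace SimpleGraph

variable {V : Type*} [Fintype V]

/-- The sum of the entries of the adjacency matrix is twice the number of edges. -/
theorem sum_sum_ite_adj_eq_two_mul_ncard_edgeSet (H : SimpleGraph V) [DecidableRel H.Adj] :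
    (∑ u, ∑ v, if H.Adj u v then (1 : ℝ) else 0) = 2 * H.edgeSet.ncard := by
  classical
  have h := H.sum_degrees_eq_twice_card_edges
  rw [← H.coe_edgeFinset, Set.ncard_coe_finset]
  have h' : ((∑ v, H.degree v : ℕ) : ℝ) = 2 * (H.edgeFinset.card : ℝ) := by
    exact_mod_cast h
  rw [← h', Nat.cast_sum]
  refine Finset.sum_congr rfl fun u _ ↦ ?_
  rw [Finset.sum_boole, ← H.card_neighborFinset_eq_degree, H.neighborFinset_eq_filter]

/-- Twice the number of edges with both endpoints in `S`, as a quadratic form evaluated at the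
indicator function of `S`. -/
theorem sum_sum_ite_adj_indicator_mul (G : SimpleGraph V) [DecidableRel G.Adj] (S : Set V) :
    (∑ u, ∑ v, if G.Adj u v then S.indicator (1 : V → ℝ) u * S.indicator 1 v else 0) =
      2 * ({e ∈ G.edgeSet | ∀ v : V, v ∈ e → v ∈ S} : Set (Sym2 V)).ncard := by
  classical
  let H : SimpleGraph V :=
    { Adj := fun u v ↦ G.Adj u v ∧ u ∈ S ∧ v ∈ S
      symm := ⟨fun _ _ h ↦ ⟨h.1.symm, h.2.2, h.2.1⟩⟩
      loopless := ⟨fun _ h ↦ G.irrefl h.1⟩ }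
  have hH : H.edgeSet = {e ∈ G.edgeSet | ∀ v : V, v ∈ e → v ∈ S} := by
    ext e
    induction e with
    | _ u v => simp [H]
  rw [← hH, ← H.sum_sum_ite_adj_eq_two_mul_ncard_edgeSet]
  refine Finset.sum_congr rfl fun u _ ↦ Finset.sum_congr rfl fun v _ ↦ ?_
  by_cases ha : G.Adj u v <;> by_cases hu : u ∈ S <;> by_cases hv : v ∈ S <;>
    simp [H, ha, hu, hv]

/-- Shifting the argument of the adjacency quadratic form of a regular graph by a constant. -/
theorem IsRegularOfDegree.sum_sum_ite_adj_sub_mul_sub {G : SimpleGraph V} [DecidableRel G.Adj]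
    {s : ℕ} (hreg : G.IsRegularOfDegree s) (x : V → ℝ) (c : ℝ) :
    (∑ u, ∑ v, if G.Adj u v then (x u - c) * (x v - c) else 0) =
      (∑ u, ∑ v, if G.Adj u v then x u * x v else 0) - 2 * c * s * ∑ v, x v +
        c ^ 2 * s * Fintype.card V := by
  have hrow (u : V) : (∑ v, if G.Adj u v then (1 : ℝ) else 0) = s := by
    rw [Finset.sum_boole, ← hreg u, ← G.card_neighborFinset_eq_degree,
      G.neighborFinset_eq_filter]
  have h₁ : (∑ u, ∑ v, if G.Adj u v then x u else 0) = s * ∑ v, x v := by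
    rw [Finset.mul_sum]
    refine Finset.sum_congr rfl fun u _ ↦ ?_
    rw [← hrow u, Finset.sum_mul]
    simp
  have h₂ : (∑ u, ∑ v, if G.Adj u v then x v else 0) = s * ∑ v, x v := by
    rw [Finset.sum_comm, ← h₁]
    simp only [G.adj_comm]
  have h₃ : (∑ u, ∑ v, if G.Adj u v then (1 : ℝ) else 0) = s * Fintype.card V := by
    simp only [hrow, Finset.sum_const, Finset.card_univ, nsmul_eq_mul, mul_comm]
  have hexp (u v : V) : (if G.Adj u v then (x u - c) * (x v - c) else 0) =
      (if G.Adj u v then x u * x v else 0) - c * (if G.Adj u v then x u else 0) -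
        c * (if G.Adj u v then x v else 0) + c ^ 2 * (if G.Adj u v then 1 else 0) := by
    split_ifs <;> ring
  simp only [hexp, Finset.sum_add_distrib, Finset.sum_sub_distrib, ← Finset.mul_sum, h₁, h₂, h₃]
  ring

end SimpleGraph

/-- Alon–Chung: the number of edges inside a subset `S` of vertices of an
`s`-regular spectral expander is at most `(γ² + (λ₂/s)·γ·(1−γ))·|E(X)|`. -/
theorem alon_chung
    {V : Type} [Fintype V] (G : SimpleGraph V) [DecidableRel G.Adj]
    (s : ℕ) (hreg : G.IsRegularOfDegree s)
    (l2 : ℝ) (hl2_nonneg : 0 ≤ l2) (hl2_lt : l2 < s)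
    (hspec : ∀ f : V → ℝ, (∑ v, f v) = 0 →
      (∑ u, ∑ v, if G.Adj u v then f u * f v else 0) ≤ l2 * ∑ v, (f v) ^ 2)
    (S : Set V) (γ : ℝ) (hγ : γ = (S.ncard : ℝ) / Fintype.card V) :
    (({e ∈ G.edgeSet | ∀ v : V, v ∈ e → v ∈ S} : Set (Sym2 V)).ncard : ℝ) ≤
      (γ ^ 2 + (l2 / s) * γ * (1 - γ)) * G.edgeSet.ncard := by
  classical
  have hs : (0 : ℝ) < s := hl2_nonneg.trans_lt hl2_lt
  have hE : (s : ℝ) * Fintype.card V = 2 * G.edgeSet.ncard := by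
    have h := hreg.sum_sum_ite_adj_sub_mul_sub 0 1
    have h' := G.sum_sum_ite_adj_eq_two_mul_ncard_edgeSet
    simp at h h'
    linarith
  let x : V → ℝ := S.indicator 1
  have hx : ∑ v, x v = S.ncard := by
    simp [x, Set.indicator_apply, Set.ncard_eq_toFinset_card']
  have hcard : (S.ncard : ℝ) = γ * Fintype.card V := by
    rcases isEmpty_or_nonempty V with hV | hV
    · simp [Set.eq_empty_of_isEmpty S]
    · rw [hγ, div_mul_cancel₀]
      exact_mod_cast Fintype.card_ne_zero
  have hsum : ∑ v, (x v - γ) = 0 := by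
    simp [Finset.sum_sub_distrib, hx, hcard, mul_comm]
  have hsq : ∑ v, (x v - γ) ^ 2 = γ * (1 - γ) * Fintype.card V := by
    have hexp (v : V) : (x v - γ) ^ 2 = (1 - 2 * γ) * x v + γ ^ 2 := by
      by_cases hv : v ∈ S <;> simp [x, hv] <;> ring
    simp only [hexp, Finset.sum_add_distrib, ← Finset.mul_sum, hx, hcard, Finset.sum_const,
      Finset.card_univ, nsmul_eq_mul]
    ring
  have hmain := hspec (fun v ↦ x v - γ) hsum
  rw [hreg.sum_sum_ite_adj_sub_mul_sub, G.sum_sum_ite_adj_indicator_mul S, hx, hcard, hsq]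
    at hmain
  have hfin : (γ ^ 2 + (l2 / s) * γ * (1 - γ)) * (G.edgeSet.ncard : ℝ) =
      (γ ^ 2 * s * Fintype.card V + l2 * (γ * (1 - γ) * Fintype.card V)) / 2 := by
    rw [show (G.edgeSet.ncard : ℝ) = s * Fintype.card V / 2 by linarith]
    field_simp
  rw [hfin]
  linarith
end

section
/- Let X be a finite simple s-regular graph with spectral bound λ₂ (0 ≤ λ₂ < s) and let γ ∈ (0,1). If a set of edges E ⊆ E(X) satisfies |E| > (γ² + (λ₂/s)·γ·(1−γ))·|E(X)|, then the set Γ(E) of vertices incident to at least one edge of E satisfies |Γ(E)| > γ·|V(X)|. -/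
/-- Twice the number of edges of a graph is the number of ordered adjacent pairs. -/
theorem SimpleGraph.sum_adj_eq_two_mul_ncard_edgeSet {V : Type*} [Fintype V] (G : SimpleGraph V)
    [DecidableRel G.Adj] :
    ∑ u, ∑ v, (if G.Adj u v then (1 : ℝ) else 0) = 2 * (G.edgeSet.ncard : ℝ) := by
  classical
  have h := G.sum_degrees_eq_twice_card_edges
  rw [← SimpleGraph.coe_edgeFinset, Set.ncard_coe_finset]
  have h2 : ∀ u, ∑ v, (if G.Adj u v then (1 : ℝ) else 0) = G.degree u := by
    intro u
    rw [Finset.sum_boole, ← SimpleGraph.card_neighborFinset_eq_degree,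
      SimpleGraph.neighborFinset_eq_filter]
  simp_rw [h2]
  exact_mod_cast h

/-- The row sums of the adjacency matrix of a regular graph. -/
theorem SimpleGraph.IsRegularOfDegree.sum_adj {V : Type*} [Fintype V] {G : SimpleGraph V}
    [DecidableRel G.Adj] {s : ℕ} (hreg : G.IsRegularOfDegree s) (u : V) :
    ∑ v, (if G.Adj u v then (1 : ℝ) else 0) = s := by
  classical
  rw [Finset.sum_boole, ← hreg u, ← SimpleGraph.card_neighborFinset_eq_degree,
    SimpleGraph.neighborFinset_eq_filter]

/-- The quadratic form of the adjacency matrix of a regular graph at a translate of `g`. -/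
theorem SimpleGraph.IsRegularOfDegree.sum_adj_sub_const {V : Type*} [Fintype V]
    {G : SimpleGraph V} [DecidableRel G.Adj] {s : ℕ} (hreg : G.IsRegularOfDegree s)
    (g : V → ℝ) (c : ℝ) :
    (∑ u, ∑ v, if G.Adj u v then (g u - c) * (g v - c) else 0) =
      (∑ u, ∑ v, if G.Adj u v then g u * g v else 0) - 2 * c * s * ∑ v, g v
        + c ^ 2 * s * Fintype.card V := by
  have hexp : ∀ u v, (if G.Adj u v then (g u - c) * (g v - c) else 0) =
      (if G.Adj u v then g u * g v else 0) - c * g u * (if G.Adj u v then (1 : ℝ) else 0)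
        - c * g v * (if G.Adj u v then (1 : ℝ) else 0)
        + c ^ 2 * (if G.Adj u v then (1 : ℝ) else 0) := by
    intro u v
    split_ifs <;> ring
  have hcol : ∑ u, ∑ v, c * g v * (if G.Adj u v then (1 : ℝ) else 0) = c * s * ∑ v, g v := by
    rw [Finset.sum_comm, Finset.mul_sum]
    refine Finset.sum_congr rfl fun v _ => ?_
    simp_rw [← Finset.mul_sum, G.adj_comm _ v, hreg.sum_adj]
    ring
  simp_rw [hexp, Finset.sum_add_distrib, Finset.sum_sub_distrib, hcol, ← Finset.mul_sum,
    hreg.sum_adj, ← Finset.sum_mul, ← Finset.mul_sum]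
  simp only [Finset.sum_const, Finset.card_univ, nsmul_eq_mul]
  ring


/-- If a set of edges `E` of an `s`-regular spectral expander satisfies
`|E| > (γ² + (λ₂/s)·γ·(1−γ))·|E(X)|`, then the set of vertices incident to
an edge of `E` has more than `γ·|V(X)|` elements. -/
theorem edge_set_incident_vertices
    {V : Type} [Fintype V] (G : SimpleGraph V) [DecidableRel G.Adj]
    (s : ℕ) (hreg : G.IsRegularOfDegree s)
    (l2 : ℝ) (hl2_nonneg : 0 ≤ l2) (hl2_lt : l2 < s)
    (hspec : ∀ f : V → ℝ, (∑ v, f v) = 0 →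
      (∑ u, ∑ v, if G.Adj u v then f u * f v else 0) ≤ l2 * ∑ v, (f v) ^ 2)
    (γ : ℝ) (hγ0 : 0 < γ) (hγ1 : γ < 1)
    (E : Set (Sym2 V)) (hE : E ⊆ G.edgeSet)
    (hEcard : (γ ^ 2 + (l2 / s) * γ * (1 - γ)) * G.edgeSet.ncard < (E.ncard : ℝ)) :
    γ * Fintype.card V < (({v : V | ∃ e ∈ E, v ∈ e} : Set V).ncard : ℝ) := by
  classical
  by_contra! hk
  set S : Set V := {v : V | ∃ e ∈ E, v ∈ e} with hS
  set g : V → ℝ := fun v => if v ∈ S then 1 else 0 with hg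
  have hs : (0 : ℝ) < s := hl2_nonneg.trans_lt hl2_lt
  have hsum : ∑ v, g v = (S.ncard : ℝ) := by
    rw [hg, Finset.sum_boole, Set.ncard_eq_toFinset_card', Set.toFinset]
    congr 2
    ext v
    simp
  have hsq : ∑ v, g v ^ 2 = (S.ncard : ℝ) := by
    rw [← hsum]
    refine Finset.sum_congr rfl fun v _ => ?_
    simp only [hg]
    split_ifs <;> norm_num
  have hedge : 2 * (G.edgeSet.ncard : ℝ) = s * Fintype.card V := by
    rw [← G.sum_adj_eq_two_mul_ncard_edgeSet]
    simp_rw [hreg.sum_adj]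
    simp [mul_comm]
  have hHE : (SimpleGraph.fromEdgeSet E).edgeSet = E := by
    rw [SimpleGraph.edgeSet_fromEdgeSet, sdiff_eq_left, Set.disjoint_left]
    intro e he hd
    exact G.not_isDiag_of_mem_edgeSet (hE he) hd
  have hEle : 2 * (E.ncard : ℝ) ≤ ∑ u, ∑ v, if G.Adj u v then g u * g v else 0 := by
    rw [← hHE, ← SimpleGraph.sum_adj_eq_two_mul_ncard_edgeSet]
    refine Finset.sum_le_sum fun u _ => Finset.sum_le_sum fun v _ => ?_
    by_cases h : (SimpleGraph.fromEdgeSet E).Adj u v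
    · have hm : s(u, v) ∈ E := ((SimpleGraph.fromEdgeSet_adj E).1 h).1
      have hu : u ∈ S := ⟨_, hm, Sym2.mem_mk_left u v⟩
      have hv : v ∈ S := ⟨_, hm, Sym2.mem_mk_right u v⟩
      have hadj : G.Adj u v := hE hm
      rw [if_pos h, if_pos hadj]
      simp [hg, hu, hv]
    · rw [if_neg h]
      simp only [hg]
      split_ifs <;> norm_num
  set n : ℝ := (Fintype.card V : ℝ) with hn
  set k : ℝ := (S.ncard : ℝ) with hkdef
  have hk0 : 0 ≤ k := Nat.cast_nonneg _
  have hn0 : 0 < n := by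
    rcases (Nat.cast_nonneg (Fintype.card V) : (0 : ℝ) ≤ n).eq_or_lt with h0 | h0
    · exfalso
      have hEG : (E.ncard : ℝ) ≤ G.edgeSet.ncard := by
        exact_mod_cast Set.ncard_le_ncard hE
      have hz : (G.edgeSet.ncard : ℝ) = 0 := by
        rw [hn, ← h0] at hedge
        linarith
      rw [hz] at hEcard hEG
      linarith
    · exact h0
  obtain ⟨x, hx⟩ : ∃ x, x = k / n := ⟨_, rfl⟩
  have hkx : k = x * n := by
    rw [hx]
    field_simp
  have hx0 : 0 ≤ x := hx ▸ div_nonneg hk0 hn0.le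
  have hxγ : x ≤ γ := by
    rw [hx, div_le_iff₀ hn0]
    exact hk
  have hzero : ∑ v, (g v - x) = 0 := by
    rw [Finset.sum_sub_distrib, hsum, Finset.sum_const, Finset.card_univ, nsmul_eq_mul, ← hn, hkx]
    ring
  have hfsq : ∑ v, (g v - x) ^ 2 = k - 2 * x * k + n * x ^ 2 := by
    simp_rw [sub_sq, Finset.sum_add_distrib, Finset.sum_sub_distrib, hsq]
    simp_rw [← Finset.sum_mul, ← Finset.mul_sum, hsum, Finset.sum_const, Finset.card_univ,
      nsmul_eq_mul, ← hn]
    ring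
  have hmix := hspec (fun v => g v - x) hzero
  rw [hreg.sum_adj_sub_const g x, hfsq, hsum, ← hn, hkx] at hmix
  have hbound : 2 * (E.ncard : ℝ) ≤ n * ((s - l2) * x ^ 2 + l2 * x) := by linarith
  have hmono : (s - l2) * x ^ 2 + l2 * x ≤ (s - l2) * γ ^ 2 + l2 * γ := by
    have := sub_nonneg.2 hl2_lt.le
    gcongr
  have hgoal : (γ ^ 2 + l2 / s * γ * (1 - γ)) * (s * n) = n * ((s - l2) * γ ^ 2 + l2 * γ) := by
    field_simp
    ring
  have hfinal := mul_le_mul_of_nonneg_left hmono hn0.le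
  rw [← hgoal, ← hedge] at hfinal
  linarith
end

section
/- (Sipser–Spielman, refined bound) Let C(X,L,Λ) be the Tanner code on a finite simple s-regular graph X with spectral bound λ₂ (0 ≤ λ₂ < s), local code L ⊆ F₂^s of minimum distance d_L, and edge labelings Λ. Then every nonzero codeword x ∈ C(X,L,Λ) has Hamming weight |x| ≥ ((d_L − λ₂)·d_L / ((s − λ₂)·s)) · |E(X)|. -/
/-- The local word of `x : E(X) → F₂` at a vertex `v`, read off via the labeling `Λ`. -/
def localWord {V : Type} [Fintype V] (G : SimpleGraph V) (s : ℕ)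
    (Λ : ∀ v : V, G.incidenceSet v ≃ Fin s) (x : G.edgeSet → ZMod 2) (v : V) :
    Fin s → ZMod 2 :=
  fun i => x ⟨((Λ v).symm i : Sym2 V), G.incidenceSet_subset v ((Λ v).symm i).2⟩

/-- The subgraph of `G` formed by the edges on which `x` does not vanish. -/
def supportGraph {V R : Type*} [Zero R] (G : SimpleGraph V) (x : G.edgeSet → R) :
    SimpleGraph V where
  Adj u v := ∃ h : s(u, v) ∈ G.edgeSet, x ⟨s(u, v), h⟩ ≠ 0
  symm := ⟨by
    rintro u v ⟨h, hx⟩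
    rw [Sym2.eq_swap] at h
    refine ⟨h, ?_⟩
    convert hx using 3
    exact Sym2.eq_swap⟩
  loopless := ⟨fun v ⟨h, _⟩ => G.loopless.irrefl v h⟩

theorem mem_edgeSet_supportGraph {V R : Type*} [Zero R] {G : SimpleGraph V} {x : G.edgeSet → R}
    {e : Sym2 V} : e ∈ (supportGraph G x).edgeSet ↔ ∃ h : e ∈ G.edgeSet, x ⟨e, h⟩ ≠ 0 := by
  induction e with
  | h u v => rfl

open Classical in
theorem card_edgeFinset_supportGraph {V R : Type*} [Fintype V] [Zero R] [DecidableEq R]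
    (G : SimpleGraph V)    [Fintype G.edgeSet] (x : G.edgeSet → R) :
    (supportGraph G x).edgeFinset.card = hammingNorm x := by
  symm
  refine Finset.card_bij (fun e _ => (e : Sym2 V)) ?_ ?_ ?_
  · intro e he
    rw [SimpleGraph.mem_edgeFinset, mem_edgeSet_supportGraph]
    exact ⟨e.2, by simpa using he⟩
  · intro a _ b _ h
    exact Subtype.ext h
  · intro e he
    rw [SimpleGraph.mem_edgeFinset, mem_edgeSet_supportGraph] at he
    obtain ⟨h, hx⟩ := he
    exact ⟨⟨e, h⟩, by simpa using hx, rfl⟩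

open Classical in
theorem degree_supportGraph {V : Type} [Fintype V] (G : SimpleGraph V) (s : ℕ)
    (Λ : ∀ v : V, G.incidenceSet v ≃ Fin s) (x : G.edgeSet → ZMod 2) (v : V) :
    (supportGraph G x).degree v = hammingNorm (localWord G s Λ x v) := by
  rw [← SimpleGraph.card_incidenceFinset_eq_degree]
  symm
  refine Finset.card_bij (fun i _ => ((Λ v).symm i : Sym2 V)) ?_ ?_ ?_
  · intro i hi
    rw [SimpleGraph.mem_incidenceFinset]
    refine ⟨mem_edgeSet_supportGraph.2 ⟨G.incidenceSet_subset v ((Λ v).symm i).2, ?_⟩,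
      ((Λ v).symm i).2.2⟩
    exact (Finset.mem_filter.1 hi).2
  · intro a _ b _ h
    exact (Λ v).symm.injective (Subtype.ext h)
  · intro e he
    rw [SimpleGraph.mem_incidenceFinset] at he
    obtain ⟨h, hx⟩ := mem_edgeSet_supportGraph.1 he.1
    refine ⟨Λ v ⟨e, h, he.2⟩, Finset.mem_filter.2 ⟨Finset.mem_univ _, ?_⟩, by simp⟩
    simpa only [localWord, Equiv.symm_apply_apply] using hx

/-- The upper bound of the expander mixing lemma for the number of (ordered) adjacent pairs
inside a set of vertices, in a form cleared of denominators. -/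
theorem card_mul_sum_adj_le {V : Type*} [Fintype V] [DecidableEq V] (G : SimpleGraph V)
    [DecidableRel G.Adj] (s : ℕ) (hreg : G.IsRegularOfDegree s) (l : ℝ)
    (hspec : ∀ f : V → ℝ, (∑ v, f v) = 0 →
      (∑ u, ∑ v, if G.Adj u v then f u * f v else 0) ≤ l * ∑ v, (f v) ^ 2)
    [Nonempty V] (S : Finset V) :
    (Fintype.card V : ℝ) * ∑ u ∈ S, ((G.neighborFinset u ∩ S).card : ℝ) ≤
      l * S.card * Fintype.card V + (s - l) * (S.card : ℝ) ^ 2 := by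
  have hn : (0 : ℝ) < Fintype.card V := by exact_mod_cast Fintype.card_pos
  set n : ℝ := (Fintype.card V : ℝ) with hn_def
  set k : ℝ := (S.card : ℝ) with hk_def
  let g : V → ℝ := fun v => if v ∈ S then 1 else 0
  have hg : ∑ v, g v = k := by simp [g, k]
  have hg2 : ∑ v, g v ^ 2 = k := by simp [g, k]
  have hdeg (u : V) : ∑ v, (if G.Adj u v then (1 : ℝ) else 0) = s := by
    rw [← hreg u, Finset.sum_boole, SimpleGraph.degree, SimpleGraph.neighborFinset_eq_filter]
  have hdeg' (v : V) : ∑ u, (if G.Adj u v then (1 : ℝ) else 0) = s := by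
    simpa only [G.adj_comm] using hdeg v
  have h1 : ∑ u, ∑ v, (if G.Adj u v then (1 : ℝ) else 0) * g u = s * k := by
    simp_rw [← Finset.sum_mul, hdeg, ← Finset.mul_sum, hg]
  have h2 : ∑ u, ∑ v, (if G.Adj u v then (1 : ℝ) else 0) * g v = s * k := by
    rw [Finset.sum_comm]
    simp_rw [← Finset.sum_mul, hdeg', ← Finset.mul_sum, hg]
  have h3 : ∑ u, ∑ v, (if G.Adj u v then (1 : ℝ) else 0) = s * n := by
    simp_rw [hdeg]
    simp [n, mul_comm]
  have h4 : ∑ u, ∑ v, (if G.Adj u v then (1 : ℝ) else 0) * (g u * g v) =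
      ∑ u ∈ S, ((G.neighborFinset u ∩ S).card : ℝ) := by
    rw [← Finset.sum_filter_add_sum_filter_not Finset.univ (· ∈ S)]
    rw [Finset.sum_eq_zero (s := Finset.univ.filter (· ∉ S)), add_zero]
    · refine Finset.sum_congr (by simp) fun u hu => ?_
      simp only [g, if_pos hu, ← ite_and, mul_ite, mul_zero, mul_one, Finset.sum_boole]
      congr 2
      ext v
      simp [and_comm]
    · intro u hu
      have hu' : u ∉ S := by simpa using hu
      simp [g, hu']
  have hsum : ∑ v, (n * g v - k) = 0 := by
    rw [Finset.sum_sub_distrib, ← Finset.mul_sum, hg]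
    simp [n]
  have key := hspec _ hsum
  have hl : (∑ u, ∑ v, if G.Adj u v then (n * g u - k) * (n * g v - k) else 0) =
      n ^ 2 * (∑ u ∈ S, ((G.neighborFinset u ∩ S).card : ℝ)) - n * s * k ^ 2 := by
    have : ∀ u v, (if G.Adj u v then (n * g u - k) * (n * g v - k) else 0) =
        n ^ 2 * ((if G.Adj u v then (1 : ℝ) else 0) * (g u * g v))
        - n * k * ((if G.Adj u v then (1 : ℝ) else 0) * g u)
        - n * k * ((if G.Adj u v then (1 : ℝ) else 0) * g v)
        + k ^ 2 * (if G.Adj u v then (1 : ℝ) else 0) := by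
      intro u v
      split_ifs <;> ring
    simp_rw [this, Finset.sum_add_distrib, Finset.sum_sub_distrib, ← Finset.mul_sum]
    rw [h1, h2, h3, h4]
    ring
  have hr : ∑ v, (n * g v - k) ^ 2 = n ^ 2 * k - n * k ^ 2 := by
    have : ∀ v, (n * g v - k) ^ 2 = n ^ 2 * g v ^ 2 - 2 * n * k * g v + k ^ 2 := by
      intro v
      ring
    simp_rw [this, Finset.sum_add_distrib, Finset.sum_sub_distrib, ← Finset.mul_sum, hg, hg2]
    simp only [Finset.sum_const, Finset.card_univ, nsmul_eq_mul, ← hn_def]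
    ring
  rw [hl, hr] at key
  refine le_of_mul_le_mul_left ?_ hn
  linarith

/-- Sipser–Spielman (refined): a nonzero codeword of the Tanner code `C(X,L,Λ)` on an
`s`-regular spectral expander `X`, with local code `L` of minimum distance `d_L`,
has weight at least `((d_L − λ₂)·d_L/((s − λ₂)·s))·|E(X)|`. -/
theorem sipser_spielman_distance
    {V : Type} [Fintype V] [DecidableEq V] (G : SimpleGraph V) [DecidableRel G.Adj]
    (s : ℕ) (hreg : G.IsRegularOfDegree s)
    (l2 : ℝ) (hl2_nonneg : 0 ≤ l2) (hl2_lt : l2 < s)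
    (hspec : ∀ f : V → ℝ, (∑ v, f v) = 0 →
      (∑ u, ∑ v, if G.Adj u v then f u * f v else 0) ≤ l2 * ∑ v, (f v) ^ 2)
    (L : Submodule (ZMod 2) (Fin s → ZMod 2)) (dL : ℕ)
    (hdL_le : ∀ c ∈ L, c ≠ 0 → dL ≤ hammingNorm c)
    (hdL_mem : ∃ c ∈ L, c ≠ 0 ∧ hammingNorm c = dL)
    (Λ : ∀ v : V, G.incidenceSet v ≃ Fin s)
    (x : G.edgeSet → ZMod 2)
    (hx : ∀ v : V, localWord G s Λ x v ∈ L)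
    (hx0 : x ≠ 0) :
    ((dL : ℝ) - l2) * dL / (((s : ℝ) - l2) * s) * G.edgeSet.ncard ≤ hammingNorm x := by
  classical
  obtain ⟨e₀, he₀⟩ := Function.ne_iff.1 hx0
  have : Nonempty V := ⟨(e₀ : Sym2 V).out.1⟩
  have hn : (0 : ℝ) < Fintype.card V := by exact_mod_cast Fintype.card_pos
  have hs : (0 : ℝ) < s := hl2_nonneg.trans_lt hl2_lt
  set H := supportGraph G x
  set S : Finset V := Finset.univ.filter fun v => localWord G s Λ x v ≠ 0
  have hmem (v : V) : v ∈ S ↔ H.degree v ≠ 0 := by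
    rw [degree_supportGraph G s Λ x v]
    simp [S]
  have hdeg : ∀ v ∈ S, dL ≤ H.degree v := by
    intro v hv
    rw [degree_supportGraph G s Λ x v]
    exact hdL_le _ (hx v) (by simpa [S] using hv)
  have hedges : 2 * (hammingNorm x : ℝ) = ∑ v ∈ S, (H.degree v : ℝ) := by
    rw [← card_edgeFinset_supportGraph]
    have h := H.sum_degrees_eq_twice_card_edges
    have hS : ∑ v ∈ S, H.degree v = ∑ v, H.degree v :=
      Finset.sum_subset (Finset.subset_univ _) fun v _ hv => by simpa [hmem] using hv
    rw [← hS] at h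
    exact_mod_cast h.symm
  have hlow : (dL : ℝ) * S.card ≤ ∑ v ∈ S, (H.degree v : ℝ) := by
    rw [mul_comm, ← nsmul_eq_mul]
    exact Finset.card_nsmul_le_sum _ _ _ fun v hv => by exact_mod_cast hdeg v hv
  have hinside : ∑ v ∈ S, (H.degree v : ℝ) ≤ ∑ v ∈ S, ((G.neighborFinset v ∩ S).card : ℝ) := by
    refine Finset.sum_le_sum fun v _ => ?_
    rw [Nat.cast_le, ← SimpleGraph.card_neighborFinset_eq_degree]
    refine Finset.card_le_card fun w hw => ?_
    rw [SimpleGraph.mem_neighborFinset] at hw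
    rw [Finset.mem_inter, SimpleGraph.mem_neighborFinset, hmem]
    exact ⟨hw.1, (H.degree_pos_iff_exists_adj w).2 ⟨v, hw.symm⟩ |>.ne'⟩
  have hSpos : (0 : ℝ) < S.card := by
    rw [Nat.cast_pos, Finset.card_pos, Finset.nonempty_iff_ne_empty]
    intro hS
    rw [hS, Finset.sum_empty] at hedges
    have : hammingNorm x = 0 := by
      rw [← @Nat.cast_eq_zero ℝ]
      linarith
    exact hx0 (hammingNorm_eq_zero.1 this)
  have hmix := card_mul_sum_adj_le G s hreg l2 hspec S
  have hexp : ((dL : ℝ) - l2) * Fintype.card V ≤ (s - l2) * S.card := by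
    refine le_of_mul_le_mul_right ?_ hSpos
    have := mul_le_mul_of_nonneg_left (hlow.trans hinside) hn.le
    linarith
  have hE : (2 : ℝ) * G.edgeSet.ncard = s * Fintype.card V := by
    have h := G.sum_degrees_eq_twice_card_edges
    simp only [hreg.degree_eq, Finset.sum_const, Finset.card_univ, smul_eq_mul] at h
    rw [← SimpleGraph.coe_edgeFinset, Set.ncard_coe_finset]
    rw [mul_comm]
    rw [mul_comm] at h
    have h' := congrArg (Nat.cast (R := ℝ)) h
    push_cast at h'
    linarith
  have hsl : (0 : ℝ) < s - l2 := sub_pos.2 hl2_lt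
  rw [div_mul_eq_mul_div, div_le_iff₀ (mul_pos hsl hs)]
  have hfinal : ((dL : ℝ) - l2) * Fintype.card V * dL ≤ (s - l2) * (2 * hammingNorm x) := by
    calc ((dL : ℝ) - l2) * Fintype.card V * dL ≤ (s - l2) * S.card * dL := by gcongr
      _ = (s - l2) * (dL * S.card) := by ring
      _ ≤ (s - l2) * (2 * hammingNorm x) := by
        rw [hedges]
        gcongr
  have h2 := mul_le_mul_of_nonneg_left hfinal hs.le
  have h3 : ((dL : ℝ) - l2) * dL * (2 * G.edgeSet.ncard) =
      s * (((dL : ℝ) - l2) * Fintype.card V * dL) := by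
    rw [hE]
    ring
  linarith
end

section
/- Let C(X,L,Λ) be a Tanner code on a finite simple s-regular graph X with spectral bound λ₂ (0 ≤ λ₂ < s), with local code L of dimension k_L whose parity-check matrix H has independent rows, and suppose the dual code L^⊥ has minimum distance d_{L^⊥}. Let δ = ∂ᵀ : F₂^{V(X)×(s−k_L)} → F₂^{E(X)} be the transpose of the Tanner differential. Let α > 0 and let y ∈ F₂^{V(X)×(s−k_L)} with |y| ≤ α·|V(X)|·(s−k_L). Then |δy| ≥ β·|y|, where β = ((d_{L^⊥} − λ₂) − α·(s−k_L)·(s−λ₂)) / ((s−k_L)·d_{L^⊥}). -/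
open scoped Classical

/-- The transpose of the Tanner differential: `(δy)(e) = Σ_{v ∋ e} Σ_j H j (Λ_v e) · y (v,j)`. -/
noncomputable def tannerCodiff {V : Type} [Fintype V] (G : SimpleGraph V) (s r : ℕ)
    (Λ : ∀ v : V, G.incidenceSet v ≃ Fin s)
    (H : Matrix (Fin r) (Fin s) (ZMod 2)) (y : V × Fin r → ZMod 2) :
    G.edgeSet → ZMod 2 :=
  fun e => ∑ v : V, ∑ j : Fin r,
    if h : (e : Sym2 V) ∈ G.incidenceSet v then H j (Λ v ⟨e, h⟩) * y (v, j) else 0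

/-- Expander mixing bound for the number of ordered adjacent pairs inside a vertex set. -/
theorem card_mul_sum_adj_le_of_spectral_bound {V : Type*} [Fintype V] [DecidableEq V] (G : SimpleGraph V)
    [DecidableRel G.Adj] {s : ℕ} (hreg : G.IsRegularOfDegree s) {l2 : ℝ}
    (hspec : ∀ f : V → ℝ, (∑ v, f v) = 0 →
      (∑ u, ∑ v, if G.Adj u v then f u * f v else 0) ≤ l2 * ∑ v, (f v) ^ 2)
    (S : Finset V) :
    (Fintype.card V : ℝ) * (∑ u, ∑ v, if G.Adj u v ∧ u ∈ S ∧ v ∈ S then (1 : ℝ) else 0)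
      ≤ (S.card : ℝ) * (l2 * Fintype.card V + (s - l2) * S.card) := by
  rcases isEmpty_or_nonempty V with hV | hV
  · simp [Finset.eq_empty_of_isEmpty S]
  have hn : (0 : ℝ) < Fintype.card V := by exact_mod_cast Fintype.card_pos
  set n : ℝ := (Fintype.card V : ℝ) with hn_def
  set m : ℝ := (S.card : ℝ) / n with hm
  have hmn : m * n = S.card := by rw [hm]; field_simp
  let g : V → ℝ := fun v => if v ∈ S then 1 else 0
  let M : V → V → ℝ := fun u v => if G.Adj u v then 1 else 0
  have hrow (u : V) : ∑ v, M u v = s := by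
    simp only [M, Finset.sum_boole]
    rw [← hreg.degree_eq u, ← G.card_neighborFinset_eq_degree, G.neighborFinset_eq_filter]
  have hsymm (u v : V) : M u v = M v u := by simp [M, G.adj_comm]
  have hg : ∑ v, g v = S.card := by simp [g]
  have hg2 (v : V) : g v ^ 2 = g v := by by_cases h : v ∈ S <;> simp [g, h]
  have hleft : ∑ u, ∑ v, M u v * g u = s * S.card := by
    simp_rw [← Finset.sum_mul, hrow, ← Finset.mul_sum, hg]
  have hright : ∑ u, ∑ v, M u v * g v = s * S.card := by
    rw [Finset.sum_comm, ← hleft]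
    simp_rw [fun u v => hsymm v u]
  have hall : ∑ u, ∑ v, M u v = s * n := by
    simp [hrow, hn_def, mul_comm]
  have key := hspec (fun v => g v - m) (by
    simp only [Finset.sum_sub_distrib, hg, Finset.sum_const, Finset.card_univ, nsmul_eq_mul]
    linarith)
  have hquad : (∑ u, ∑ v, if G.Adj u v then (g u - m) * (g v - m) else 0)
      = (∑ u, ∑ v, if G.Adj u v ∧ u ∈ S ∧ v ∈ S then (1 : ℝ) else 0)
        - m * (s * S.card) - m * (s * S.card) + m ^ 2 * (s * n) := by
    rw [← hall]
    nth_rewrite 1 [← hleft]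
    rw [← hright]
    simp only [Finset.mul_sum, ← Finset.sum_sub_distrib, ← Finset.sum_add_distrib]
    refine Finset.sum_congr rfl fun u _ => Finset.sum_congr rfl fun v _ => ?_
    by_cases h : G.Adj u v <;> by_cases hu : u ∈ S <;> by_cases hv : v ∈ S <;>
      simp [M, g, h, hu, hv] <;> ring
  have hsq : ∑ v, (g v - m) ^ 2 = S.card - 2 * m * S.card + m ^ 2 * n := by
    simp_rw [sub_sq, hg2, Finset.sum_add_distrib, Finset.sum_sub_distrib]
    simp_rw [mul_right_comm _ (g _) m, ← Finset.mul_sum, hg]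
    simp [hn_def]
    ring
  rw [hquad, hsq] at key
  have := mul_le_mul_of_nonneg_left key hn.le
  rw [← hmn] at this ⊢
  linarith

/-- The local word `Hᵀ w` of a nonzero `w` is nonzero and orthogonal to `ker H`, so its weight is
at least the dual distance. -/
theorem dualDistance_le_hammingNorm_vecMul {s r : ℕ} {L : Submodule (ZMod 2) (Fin s → ZMod 2)}
    {H : Matrix (Fin r) (Fin s) (ZMod 2)}
    (hH : ∀ c ∈ L, H.mulVec c = 0)
    (hHrows : LinearIndependent (ZMod 2) (fun i => H i)) {d : ℕ}
    (hd : ∀ z : Fin s → ZMod 2, (∀ c ∈ L, ∑ i, z i * c i = 0) → z ≠ 0 → d ≤ hammingNorm z)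
    {w : Fin r → ZMod 2} (hw : w ≠ 0) :
    d ≤ hammingNorm (Matrix.vecMul w H) := by
  refine hd _ (fun c hc => ?_) fun h => hw ?_
  · change Matrix.vecMul w H ⬝ᵥ c = 0
    rw [← Matrix.dotProduct_mulVec, hH c hc, dotProduct_zero]
  · have hinj := Matrix.vecMul_injective_iff.mpr hHrows
    exact hinj (by simpa using h)

/-- The contribution of the checks at `v` to `tannerCodiff`. -/
noncomputable def tannerCodiffAt {V : Type} (G : SimpleGraph V) {s r : ℕ}
    (Λ : ∀ v : V, G.incidenceSet v ≃ Fin s)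
    (H : Matrix (Fin r) (Fin s) (ZMod 2)) (y : V × Fin r → ZMod 2) (v : V)
    (e : G.edgeSet) : ZMod 2 :=
  ∑ j : Fin r, if h : (e : Sym2 V) ∈ G.incidenceSet v then H j (Λ v ⟨e, h⟩) * y (v, j) else 0

section

variable {V : Type} (G : SimpleGraph V) {s r : ℕ} (Λ : ∀ v : V, G.incidenceSet v ≃ Fin s)
  (H : Matrix (Fin r) (Fin s) (ZMod 2)) (y : V × Fin r → ZMod 2)

theorem tannerCodiffAt_eq_zero_of_notMem {v : V} {e : G.edgeSet} (h : v ∉ (e : Sym2 V)) :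
    tannerCodiffAt G Λ H y v e = 0 := by
  have : (e : Sym2 V) ∉ G.incidenceSet v := fun h' => h h'.2
  simp [tannerCodiffAt, this]

theorem tannerCodiffAt_eq_zero_of_forall {v : V} (h : ∀ j, y (v, j) = 0) (e : G.edgeSet) :
    tannerCodiffAt G Λ H y v e = 0 := by
  simp [tannerCodiffAt, h]

theorem tannerCodiffAt_symm (v : V) (i : Fin s) :
    tannerCodiffAt G Λ H y v ⟨(Λ v).symm i, ((Λ v).symm i).2.1⟩
      = Matrix.vecMul (fun j => y (v, j)) H i := by
  simp [tannerCodiffAt, Matrix.vecMul, dotProduct, mul_comm]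

theorem hammingNorm_vecMul_le_hammingNorm_tannerCodiffAt [Fintype G.edgeSet] (v : V) :
    hammingNorm (Matrix.vecMul (fun j => y (v, j)) H)
      ≤ hammingNorm (tannerCodiffAt G Λ H y v) := by
  refine Finset.card_le_card_of_injOn
    (fun i => (⟨(Λ v).symm i, ((Λ v).symm i).2.1⟩ : G.edgeSet)) (fun i hi => ?_) fun i _ j _ hij => ?_
  · simpa [tannerCodiffAt_symm] using hi
  · exact (Λ v).symm.injective (Subtype.ext (by simpa only [Subtype.mk.injEq] using hij))

/-- On a single edge, cancellation in `tannerCodiff` requires both endpoints to carry nonzero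
checks. -/
theorem sum_tannerCodiffAt_ne_zero_le [Fintype V] {S : Finset V}
    (hS : ∀ v ∉ S, ∀ j, y (v, j) = 0) (e : G.edgeSet) :
    (∑ v, if tannerCodiffAt G Λ H y v e ≠ 0 then (1 : ℝ) else 0)
      ≤ (if tannerCodiff G s r Λ H y e ≠ 0 then (1 : ℝ) else 0)
        + ∑ u, ∑ v, if (G.Adj u v ∧ u ∈ S ∧ v ∈ S) ∧ (e : Sym2 V) = s(u, v)
          then (1 : ℝ) else 0 := by
  have hδ : tannerCodiff G s r Λ H y e = ∑ v, tannerCodiffAt G Λ H y v e := rfl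
  obtain ⟨e, he⟩ := e
  induction e with
  | _ x w =>
  have hadj : G.Adj x w := he
  set a : V → ZMod 2 := fun v => tannerCodiffAt G Λ H y v ⟨s(x, w), he⟩ with ha
  have hzero : ∀ v, v ≠ x ∧ v ≠ w → a v = 0 := fun v hv =>
    tannerCodiffAt_eq_zero_of_notMem G Λ H y (by simpa using hv)
  have hmem : ∀ v, a v ≠ 0 → v ∈ S := fun v hv => by
    by_contra h
    exact hv (tannerCodiffAt_eq_zero_of_forall G Λ H y (hS v h) _)
  change (∑ v, if a v ≠ 0 then (1 : ℝ) else 0) ≤ _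
  rw [hδ, Fintype.sum_eq_add x w hadj.ne hzero,
    Fintype.sum_eq_add x w hadj.ne (fun v hv => by simp [hzero v hv])]
  set F : V → V → ℝ := fun u v =>
    if (G.Adj u v ∧ u ∈ S ∧ v ∈ S) ∧ s(x, w) = s(u, v) then (1 : ℝ) else 0 with hF
  have hF0 : ∀ u v, 0 ≤ F u v := fun u v => by simp only [hF]; split_ifs <;> norm_num
  change _ ≤ (if a x + a w ≠ 0 then (1 : ℝ) else 0) + ∑ u, ∑ v, F u v
  have hsum : F x w + F w x ≤ ∑ u, ∑ v, F u v :=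
    calc F x w + F w x ≤ ∑ v, F x v + ∑ v, F w v :=
          add_le_add (Finset.single_le_sum (fun v _ => hF0 x v) (Finset.mem_univ w))
            (Finset.single_le_sum (fun v _ => hF0 w v) (Finset.mem_univ x))
      _ ≤ ∑ u, ∑ v, F u v :=
          Finset.add_le_sum (fun u _ => Finset.sum_nonneg fun v _ => hF0 u v)
            (Finset.mem_univ x) (Finset.mem_univ w) hadj.ne
  have hxw := hF0 x w
  have hwx := hF0 w x
  by_cases hx : a x = 0 <;> by_cases hw : a w = 0
  · simp [hx, hw]; linarith
  · simp [hx, hw]; linarith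
  · simp [hx, hw]; linarith
  · have h1 : F x w = 1 := by simp [hF, hadj, hmem x hx, hmem w hw]
    have h2 : F w x = 1 := by simp [hF, hadj.symm, hmem x hx, hmem w hw]
    have h3 : (0 : ℝ) ≤ if a x + a w ≠ 0 then 1 else 0 := by split_ifs <;> norm_num
    rw [if_pos hx, if_pos hw]
    linarith

/-- Counting over all edges: the local weights are covered by the weight of `tannerCodiff` and the
ordered adjacent pairs inside `S`. -/
theorem sum_hammingNorm_tannerCodiffAt_le [Fintype V] [Fintype G.edgeSet] [DecidableRel G.Adj]
    [DecidableEq V] {S : Finset V} (hS : ∀ v ∉ S, ∀ j, y (v, j) = 0) :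
    (∑ v, (hammingNorm (tannerCodiffAt G Λ H y v) : ℝ))
      ≤ hammingNorm (tannerCodiff G s r Λ H y)
        + ∑ u, ∑ v, if G.Adj u v ∧ u ∈ S ∧ v ∈ S then (1 : ℝ) else 0 := by
  have hnorm (x : G.edgeSet → ZMod 2) :
      (hammingNorm x : ℝ) = ∑ e, if x e ≠ 0 then (1 : ℝ) else 0 := by
    simp only [hammingNorm, Finset.sum_boole]
  have hpair (u v : V) : (∑ e : G.edgeSet,
      if (G.Adj u v ∧ u ∈ S ∧ v ∈ S) ∧ (e : Sym2 V) = s(u, v) then (1 : ℝ) else 0)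
        = if G.Adj u v ∧ u ∈ S ∧ v ∈ S then (1 : ℝ) else 0 := by
    by_cases h : G.Adj u v ∧ u ∈ S ∧ v ∈ S
    · rw [Fintype.sum_eq_single (⟨s(u, v), h.1⟩ : G.edgeSet)]
      · simp [h]
      · intro e he
        exact if_neg fun h' => he (Subtype.ext h'.2)
    · simp [h]
  have h := Finset.sum_le_sum fun e (_ : e ∈ Finset.univ) =>
    sum_tannerCodiffAt_ne_zero_le G Λ H y hS e
  rw [Finset.sum_comm, Finset.sum_add_distrib, Finset.sum_comm (t := (Finset.univ : Finset V))] at h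
  simp_rw [hnorm]
  refine h.trans (add_le_add ?_ ?_)
  · exact le_rfl
  · refine le_of_eq (Finset.sum_congr rfl fun u _ => ?_)
    rw [Finset.sum_comm]
    refine Finset.sum_congr rfl fun v _ => ?_
    convert hpair u v

end

/-- Small sets of checks of a Tanner code on a spectral expander involve many bits:
the transposed differential is expanding. -/
theorem tanner_coexpansion
    {V : Type} [Fintype V] [DecidableEq V] (G : SimpleGraph V) [DecidableRel G.Adj]
    (s : ℕ) (hreg : G.IsRegularOfDegree s)
    (l2 : ℝ) (hl2_nonneg : 0 ≤ l2) (hl2_lt : l2 < s)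
    (hspec : ∀ f : V → ℝ, (∑ v, f v) = 0 →
      (∑ u, ∑ v, if G.Adj u v then f u * f v else 0) ≤ l2 * ∑ v, (f v) ^ 2)
    (kL : ℕ) (hkL : kL ≤ s)
    (L : Submodule (ZMod 2) (Fin s → ZMod 2)) (hLdim : Module.finrank (ZMod 2) L = kL)
    (H : Matrix (Fin (s - kL)) (Fin s) (ZMod 2))
    (hH : ∀ c : Fin s → ZMod 2, H.mulVec c = 0 ↔ c ∈ L)
    (hHrows : LinearIndependent (ZMod 2) (fun i => H i))
    (dLd : ℕ)
    (hdLd_le : ∀ z : Fin s → ZMod 2, (∀ c ∈ L, ∑ i, z i * c i = 0) → z ≠ 0 →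
      dLd ≤ hammingNorm z)
    (hdLd_mem : ∃ z : Fin s → ZMod 2, (∀ c ∈ L, ∑ i, z i * c i = 0) ∧ z ≠ 0 ∧
      hammingNorm z = dLd)
    (Λ : ∀ v : V, G.incidenceSet v ≃ Fin s)
    (α : ℝ) (hα : 0 < α)
    (y : V × Fin (s - kL) → ZMod 2)
    (hy : (hammingNorm y : ℝ) ≤ α * Fintype.card V * (s - kL : ℕ)) :
    (((dLd : ℝ) - l2) - α * ((s : ℝ) - (kL : ℕ)) * ((s : ℝ) - l2)) /
        (((s : ℝ) - (kL : ℕ)) * dLd) * hammingNorm y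
      ≤ hammingNorm (tannerCodiff G s (s - kL) Λ H y) := by
  have hrs : (s : ℝ) - (kL : ℕ) = (s - kL : ℕ) := (Nat.cast_sub hkL).symm
  rw [hrs]
  clear hrs
  generalize s - kL = r at *
  obtain ⟨z, -, hz, hzd⟩ := hdLd_mem
  have hd1 : (1 : ℝ) ≤ dLd := by
    exact_mod_cast hzd ▸ hammingNorm_pos_iff.mpr hz
  set S : Finset V := Finset.univ.filter fun v => (fun j => y (v, j)) ≠ 0 with hSdef
  have hS : ∀ v ∉ S, ∀ j, y (v, j) = 0 := fun v hv j => by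
    have : (fun j => y (v, j)) = 0 := by simpa [hSdef] using hv
    exact congrFun this j
  have hSy : S.card ≤ hammingNorm y := by
    have : S ⊆ (Finset.univ.filter fun p => y p ≠ 0).image Prod.fst := fun v hv => by
      obtain ⟨j, hj⟩ := Function.ne_iff.mp (Finset.mem_filter.mp hv).2
      exact Finset.mem_image.mpr ⟨(v, j), by simpa using hj, rfl⟩
    exact (Finset.card_le_card this).trans Finset.card_image_le
  have hyS : hammingNorm y ≤ S.card * r := by
    have : (Finset.univ.filter fun p => y p ≠ 0) ⊆ S ×ˢ (Finset.univ : Finset (Fin r)) := by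
      rintro ⟨v, j⟩ hp
      simp only [Finset.mem_product, Finset.mem_univ, and_true]
      by_contra h
      exact (Finset.mem_filter.mp hp).2 (hS v h j)
    simpa [hammingNorm] using Finset.card_le_card this
  have hlocal : (S.card : ℝ) * dLd
      ≤ ∑ v, (hammingNorm (tannerCodiffAt G Λ H y v) : ℝ) := by
    rw [← nsmul_eq_mul]
    refine (Finset.card_nsmul_le_sum S _ _ fun v hv => ?_).trans
      (Finset.sum_le_sum_of_subset_of_nonneg (Finset.subset_univ S) fun v _ _ => by positivity)
    exact_mod_cast (dualDistance_le_hammingNorm_vecMul (fun c hc => (hH c).mpr hc) hHrows hdLd_le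
      (Finset.mem_filter.mp hv).2).trans
        (hammingNorm_vecMul_le_hammingNorm_tannerCodiffAt G Λ H y v)
  have hcount := hlocal.trans (sum_hammingNorm_tannerCodiffAt_le G Λ H y hS)
  have hmix := card_mul_sum_adj_le_of_spectral_bound G hreg hspec S
  set D : ℝ := (hammingNorm (tannerCodiff G s r Λ H y) : ℝ)
  have hD : 0 ≤ D := Nat.cast_nonneg _
  set B : ℝ := dLd - l2 - α * r * (s - l2) with hB
  have hSy' : (S.card : ℝ) ≤ hammingNorm y := by exact_mod_cast hSy
  have hyS' : (hammingNorm y : ℝ) ≤ S.card * r := by exact_mod_cast hyS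
  rcases le_or_gt B 0 with hB0 | hB0
  · refine le_trans (mul_nonpos_of_nonpos_of_nonneg ?_ (Nat.cast_nonneg _)) hD
    exact div_nonpos_of_nonpos_of_nonneg hB0 (by positivity)
  rcases S.eq_empty_or_nonempty with hSe | hSne
  · have : (hammingNorm y : ℝ) = 0 := le_antisymm (by simpa [hSe] using hyS') (Nat.cast_nonneg _)
    rw [this, mul_zero]
    exact hD
  have hn : (0 : ℝ) < Fintype.card V := by
    exact_mod_cast Fintype.card_pos_iff.mpr ⟨hSne.choose⟩
  have hSB : (S.card : ℝ) * B ≤ D := by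
    have hA : (∑ u, ∑ v, if G.Adj u v ∧ u ∈ S ∧ v ∈ S then (1 : ℝ) else 0)
        ≤ S.card * (l2 + α * r * (s - l2)) := by
      refine le_of_mul_le_mul_left (hmix.trans ?_) hn
      rw [mul_left_comm]
      refine mul_le_mul_of_nonneg_left ?_ (Nat.cast_nonneg _)
      have := mul_le_mul_of_nonneg_left (hSy'.trans hy) (sub_nonneg.mpr hl2_lt.le)
      linarith
    rw [hB]
    linarith
  have hr0 : (0 : ℝ) < r := by
    have hp : (0 : ℝ) < S.card := by exact_mod_cast hSne.card_pos
    exact pos_of_mul_pos_right (hp.trans_le (hSy'.trans hyS')) hp.le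
  rw [div_mul_eq_mul_div, div_le_iff₀ (by positivity)]
  calc B * hammingNorm y ≤ B * (S.card * r) := mul_le_mul_of_nonneg_left hyS' hB0.le
    _ = S.card * B * r := by ring
    _ ≤ D * r := mul_le_mul_of_nonneg_right hSB hr0.le
    _ ≤ D * (r * dLd) :=
      mul_le_mul_of_nonneg_left (le_mul_of_one_le_right hr0.le hd1) hD
end

section
/- (Gilbert–Varshamov+) Let δ ∈ (0, 0.11) and let n be a natural number with n > 2/(1/2 − H₂(δ)), where H₂(δ) = −δ·log₂(δ) − (1−δ)·log₂(1−δ). Then there exists an F₂-linear subspace C ⊆ F₂ⁿ such that dim C > n/2, every nonzero c ∈ C has Hamming weight |c| ≥ δ·n, and every nonzero c ∈ C^⊥ has Hamming weight |c| ≥ δ·n. -/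
/-- The binary entropy function. -/
noncomputable def binaryEntropy (δ : ℝ) : ℝ :=
  -δ * Real.logb 2 δ - (1 - δ) * Real.logb 2 (1 - δ)

open Finset in
/-- All fibres of a surjective additive homomorphism between finite groups have equal size. -/
lemma AddMonoidHom.card_fiber_mul_card {G H : Type*} [AddCommGroup G] [Fintype G] [AddCommGroup H]
    [Fintype H] [DecidableEq H] (f : G →+ H) (hf : Function.Surjective f) (z : H) :
    #{g | f g = z} * Fintype.card H = Fintype.card G := by
  have h := Finset.card_eq_sum_card_fiberwise (s := (univ : Finset G)) (t := (univ : Finset H))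
    (f := f) (by simp)
  rw [← Finset.card_univ (α := G), h, Finset.sum_congr rfl fun w _ =>
    AddMonoidHom.card_fiber_eq_of_mem_range f (hf w) (hf z)]
  simp [mul_comm]

namespace Matrix

variable {K α β : Type*} [Field K] [Fintype K] [DecidableEq K]
  [Fintype α] [DecidableEq α] [Fintype β] [DecidableEq β]

open Finset in
/-- A nonzero vector is sent to a given vector by a fraction `q ^ (-|β|)` of all matrices. -/
lemma card_mulVec_eq_mul {x : α → K} (hx : x ≠ 0) (z : β → K) :
    #{A : Matrix β α K | A *ᵥ x = z} * Fintype.card K ^ Fintype.card β =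
      Fintype.card (Matrix β α K) := by
  obtain ⟨a, ha⟩ := Function.ne_iff.1 hx
  have ha : x a ≠ 0 := ha
  have h := AddMonoidHom.card_fiber_mul_card
    (⟨⟨fun A : Matrix β α K => A *ᵥ x, zero_mulVec x⟩, fun A B => add_mulVec A B x⟩ :
      Matrix β α K →+ (β → K))
    (fun w => ⟨vecMulVec w (Pi.single a (x a)⁻¹), by
      ext b
      simp [mulVec, vecMulVec, dotProduct, Pi.single_apply, ha]⟩) z
  simpa using h

open Finset in
/-- A nonzero row vector is sent to a given vector by a fraction `q ^ (-|α|)` of all matrices. -/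
lemma card_vecMul_eq_mul {y : β → K} (hy : y ≠ 0) (z : α → K) :
    #{A : Matrix β α K | y ᵥ* A = z} * Fintype.card K ^ Fintype.card α =
      Fintype.card (Matrix β α K) := by
  obtain ⟨b, hb⟩ := Function.ne_iff.1 hy
  have hb : y b ≠ 0 := hb
  have h := AddMonoidHom.card_fiber_mul_card
    (⟨⟨fun A : Matrix β α K => y ᵥ* A, vecMul_zero y⟩, fun A B => vecMul_add A B y⟩ :
      Matrix β α K →+ (α → K))
    (fun w => ⟨vecMulVec (Pi.single b (y b)⁻¹) w, by
      ext a
      simp [vecMul, vecMulVec, dotProduct, Pi.single_apply, hb]⟩) z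
  simpa using h

end Matrix

open Matrix in
/-- The encoder `x ↦ (x, A x)` of the systematic linear code with parity matrix `A`. -/
def systematicEncoder {K α β ι : Type*} [Field K] [Fintype α]
    (e : α ⊕ β ≃ ι) (A : Matrix β α K) : (α → K) →ₗ[K] (ι → K) where
  toFun x i := Sum.elim x (A *ᵥ x) (e.symm i)
  map_add' x y := by
    ext i
    rcases h : e.symm i with a | b <;> simp [h, mulVec_add]
  map_smul' c x := by
    ext i
    rcases h : e.symm i with a | b <;> simp [h, mulVec_smul]

section systematicEncoder

variable {K α β ι : Type*} [Field K] [Fintype α] (e : α ⊕ β ≃ ι)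

@[simp]
lemma systematicEncoder_inl (A : Matrix β α K) (x : α → K) (a : α) :
    systematicEncoder e A x (e (.inl a)) = x a := by
  simp [systematicEncoder]

open Matrix in
@[simp]
lemma systematicEncoder_inr (A : Matrix β α K) (x : α → K) (b : β) :
    systematicEncoder e A x (e (.inr b)) = (A *ᵥ x) b := by
  simp [systematicEncoder]

lemma systematicEncoder_injective (A : Matrix β α K) :
    Function.Injective (systematicEncoder e A) := fun x y h => by
  ext a
  simpa using congrFun h (e (.inl a))

open Matrix in
lemma eq_neg_vecMul_of_orthogonal_systematicEncoder [DecidableEq α] [Fintype β]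
    [Fintype ι] (A : Matrix β α K) (c : ι → K) (hc : ∀ x, ∑ i, systematicEncoder e A x i * c i = 0) :
    (fun a => c (e (.inl a))) = -((fun b => c (e (.inr b))) ᵥ* A) := by
  ext a
  have h := hc (Pi.single a 1)
  rw [← e.sum_comp, Fintype.sum_sum_type] at h
  simp only [systematicEncoder_inl, systematicEncoder_inr, mulVec_single_one] at h
  simp only [Pi.single_apply, ite_mul, one_mul, zero_mul, Finset.sum_ite_eq',
    Finset.mem_univ, if_true] at h
  rw [eq_neg_of_add_eq_zero_left h]
  simp [vecMul, dotProduct, mul_comm]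

end systematicEncoder

open Finset Matrix in
/-- If a set `B` of nonzero vectors is small enough, some linear code of dimension `|α|` avoids it
together with its dual. -/
lemma exists_submodule_disjoint_dual_disjoint {K α β ι : Type*} [Field K] [Fintype K]
    [Fintype α] [Fintype β] [Fintype ι] (e : α ⊕ β ≃ ι) (B : Finset (ι → K)) (h0 : 0 ∉ B)
    (hB : #B * (Fintype.card K ^ Fintype.card α + Fintype.card K ^ Fintype.card β) <
      Fintype.card K ^ (Fintype.card α + Fintype.card β)) :
    ∃ C : Submodule K (ι → K), Module.finrank K C = Fintype.card α ∧
      (∀ c ∈ C, c ∉ B) ∧ ∀ c : ι → K, (∀ x ∈ C, ∑ i, x i * c i = 0) → c ∉ B := by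
  classical
  set q := Fintype.card K
  set N := Fintype.card (Matrix β α K) with hN
  have hNpos : 0 < N := Fintype.card_pos
  let l (v : ι → K) : α → K := fun a => v (e (.inl a))
  let r (v : ι → K) : β → K := fun b => v (e (.inr b))
  have hlr {v : ι → K} (hl : l v = 0) (hr : r v = 0) : v = 0 := by
    ext i
    obtain ⟨s, rfl⟩ := e.surjective i
    rcases s with a | b
    · exact congrFun hl a
    · exact congrFun hr b
  let P (v : ι → K) : Finset (Matrix β α K) := {A | A *ᵥ l v = r v}
  let D (v : ι → K) : Finset (Matrix β α K) := {A | r v ᵥ* A = -l v}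
  have hP {v} (hv : v ∈ B) : #(P v) * q ^ Fintype.card β ≤ N := by
    by_cases hl : l v = 0
    · have hr : r v ≠ 0 := fun hr => h0 (hlr hl hr ▸ hv)
      simp [P, hl, hr.symm]
    · exact (card_mulVec_eq_mul hl _).le
  have hD {v} (hv : v ∈ B) : #(D v) * q ^ Fintype.card α ≤ N := by
    by_cases hr : r v = 0
    · have hl : l v ≠ 0 := fun hl => h0 (hlr hl hr ▸ hv)
      simp [D, hr, hl]
    · exact (card_vecMul_eq_mul hr _).le
  have hcard : #(B.biUnion fun v => P v ∪ D v) < N := by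
    refine lt_of_mul_lt_mul_right ?_ (Nat.zero_le (q ^ (Fintype.card α + Fintype.card β)))
    calc _ ≤ (∑ v ∈ B, (#(P v) + #(D v))) * q ^ (Fintype.card α + Fintype.card β) := by
            gcongr
            exact card_biUnion_le.trans (sum_le_sum fun v _ => card_union_le _ _)
      _ = ∑ v ∈ B, (#(P v) * q ^ Fintype.card β * q ^ Fintype.card α +
            #(D v) * q ^ Fintype.card α * q ^ Fintype.card β) := by
            rw [sum_mul]
            refine sum_congr rfl fun v _ => ?_
            ring
      _ ≤ ∑ v ∈ B, (N * q ^ Fintype.card α + N * q ^ Fintype.card β) := by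
            refine sum_le_sum fun v hv => ?_
            gcongr
            exacts [hP hv, hD hv]
      _ = N * (#B * (q ^ Fintype.card α + q ^ Fintype.card β)) := by
            rw [sum_const, smul_eq_mul]
            ring
      _ < N * q ^ (Fintype.card α + Fintype.card β) := by gcongr
  obtain ⟨A, -, hA⟩ := exists_mem_notMem_of_card_lt_card (hcard.trans_eq hN)
  simp only [mem_biUnion, mem_union, not_exists, not_and, not_or, P, D, mem_filter, mem_univ,
    true_and] at hA
  refine ⟨LinearMap.range (systematicEncoder e A), ?_, ?_, fun c hc hcB => ?_⟩
  · rw [LinearMap.finrank_range_of_inj (systematicEncoder_injective e A),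
      Module.finrank_fintype_fun_eq_card]
  · rintro _ ⟨x, rfl⟩ hxB
    refine (hA _ hxB).1 ?_
    ext b
    simp [l, r]
  · refine (hA c hcB).2 ?_
    rw [show l c = _ from eq_neg_vecMul_of_orthogonal_systematicEncoder e A c
      fun x => hc _ ⟨x, rfl⟩, neg_neg]

lemma binaryEntropy_eq_binEntropy_div (δ : ℝ) :
    binaryEntropy δ = Real.binEntropy δ / Real.log 2 := by
  rw [binaryEntropy, Real.binEntropy_eq_negMulLog_add_negMulLog_one_sub, Real.negMulLog,
    Real.negMulLog, Real.logb, Real.logb]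
  ring

lemma binaryEntropy_lt_half {δ : ℝ} (hδ0 : 0 < δ) (hδ1 : δ < 0.11) :
    binaryEntropy δ < 1 / 2 := by
  have hlog2 : 0 < Real.log 2 := Real.log_pos one_lt_two
  have hmono : Real.binEntropy δ < Real.binEntropy (11 / 100) :=
    Real.binEntropy_strictMonoOn ⟨hδ0.le, by norm_num at hδ1 ⊢; linarith⟩ (by norm_num)
      (by norm_num at hδ1 ⊢; linarith)
  have hlog : Real.log ((100 : ℝ) ^ 100) < Real.log (2 ^ 50 * (11 ^ 11 * 89 ^ 89)) :=
    Real.log_lt_log (by norm_num) (by norm_num)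
  rw [Real.log_mul (by norm_num) (by norm_num), Real.log_mul (by norm_num) (by norm_num)] at hlog
  simp only [Real.log_pow] at hlog
  have heq : Real.binEntropy (11 / 100) =
      (100 * Real.log 100 - 11 * Real.log 11 - 89 * Real.log 89) / 100 := by
    rw [Real.binEntropy_eq_negMulLog_add_negMulLog_one_sub, Real.negMulLog, Real.negMulLog,
      show (1 - 11 / 100 : ℝ) = 89 / 100 by norm_num, Real.log_div (by norm_num) (by norm_num),
      Real.log_div (by norm_num) (by norm_num)]
    ring
  rw [binaryEntropy_eq_binEntropy_div, div_lt_iff₀ hlog2]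
  push_cast at hlog
  linarith

lemma rpow_mul_rpow_eq_two_rpow_neg_binaryEntropy {δ : ℝ} (hδ0 : 0 < δ) (hδ1 : δ < 1) (t : ℝ) :
    δ ^ (δ * t) * (1 - δ) ^ ((1 - δ) * t) = (2 : ℝ) ^ (-(binaryEntropy δ * t)) := by
  have hlog2 : Real.log 2 ≠ 0 := (Real.log_pos one_lt_two).ne'
  rw [Real.rpow_def_of_pos hδ0, Real.rpow_def_of_pos (sub_pos.2 hδ1),
    Real.rpow_def_of_pos two_pos, ← Real.exp_add, binaryEntropy, Real.logb, Real.logb]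
  congr 1
  field_simp
  ring

lemma prod_ite_eq_zero_eq_pow_hammingNorm {ι : Type*} [Fintype ι] (a b : ℝ) (v : ι → ZMod 2) :
    ∏ i, (if v i = 0 then a else b) =
      a ^ (Fintype.card ι - hammingNorm v) * b ^ hammingNorm v := by
  rw [Finset.prod_ite, Finset.prod_const, Finset.prod_const]
  congr 2
  have := Finset.card_filter_add_card_filter_not (s := (Finset.univ : Finset ι)) (fun i => v i = 0)
  rw [Finset.card_univ] at this
  exact Nat.eq_sub_of_add_eq this

lemma sum_pow_hammingNorm {ι : Type*} [Fintype ι] [DecidableEq ι] (a b : ℝ) :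
    ∑ v : ι → ZMod 2, a ^ (Fintype.card ι - hammingNorm v) * b ^ hammingNorm v =
      (a + b) ^ Fintype.card ι := by
  simp_rw [← prod_ite_eq_zero_eq_pow_hammingNorm]
  rw [← Fintype.prod_sum fun (_ : ι) (z : ZMod 2) => if z = 0 then a else b]
  have h : ∑ z : ZMod 2, (if z = 0 then a else b) = a + b := Fin.sum_univ_two _
  simp [h]

open Finset in
/-- The entropy bound on the size of a Hamming ball. -/
lemma card_hammingNorm_lt_le_two_rpow {ι : Type*} [Fintype ι] [DecidableEq ι] {δ : ℝ}
    (hδ0 : 0 < δ) (hδ1 : δ ≤ 1 / 2) (S : Finset (ι → ZMod 2))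
    (hS : ∀ v ∈ S, (hammingNorm v : ℝ) ≤ δ * Fintype.card ι) :
    (#S : ℝ) ≤ 2 ^ (binaryEntropy δ * Fintype.card ι) := by
  set n := Fintype.card ι
  have h1 : 0 < 1 - δ := by linarith
  have hterm : ∀ v ∈ S, (2 : ℝ) ^ (-(binaryEntropy δ * n)) ≤
      (1 - δ) ^ (n - hammingNorm v) * δ ^ hammingNorm v := by
    intro v hv
    have hle : hammingNorm v ≤ n := hammingNorm_le_card_fintype
    rw [← rpow_mul_rpow_eq_two_rpow_neg_binaryEntropy hδ0 (by linarith), ← Real.rpow_natCast,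
      ← Real.rpow_natCast, Nat.cast_sub hle]
    set w : ℝ := ((hammingNorm v : ℕ) : ℝ)
    calc δ ^ (δ * n) * (1 - δ) ^ ((1 - δ) * n)
        = δ ^ (δ * n - w) * δ ^ w * (1 - δ) ^ ((1 - δ) * n) := by
          rw [← Real.rpow_add hδ0, sub_add_cancel]
      _ ≤ (1 - δ) ^ (δ * n - w) * δ ^ w * (1 - δ) ^ ((1 - δ) * n) := by
          gcongr ?_ * _ * _
          exact Real.rpow_le_rpow hδ0.le (by linarith) (sub_nonneg.2 (hS v hv))
      _ = (1 - δ) ^ (n - w) * δ ^ w := by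
          rw [mul_right_comm, ← Real.rpow_add h1]
          congr 2
          ring
  have hsum : (#S : ℝ) * 2 ^ (-(binaryEntropy δ * n)) ≤ 1 := by
    calc (#S : ℝ) * 2 ^ (-(binaryEntropy δ * n))
        ≤ ∑ v ∈ S, (1 - δ) ^ (n - hammingNorm v) * δ ^ hammingNorm v := by
          simpa using sum_le_sum hterm
      _ ≤ ∑ v : ι → ZMod 2, (1 - δ) ^ (n - hammingNorm v) * δ ^ hammingNorm v :=
          sum_le_univ_sum_of_nonneg fun v => by positivity
      _ = 1 := by rw [sum_pow_hammingNorm]; simp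
  rwa [Real.rpow_neg two_pos.le, mul_inv_le_iff₀ (by positivity), one_mul] at hsum

/-- Gilbert–Varshamov+ : for `δ ∈ (0, 0.11)` and `n > 2/(1/2 − H₂(δ))` there is a binary
linear code of length `n`, dimension `> n/2`, distance `≥ δn`, whose dual also has
distance `≥ δn`. -/
theorem gilbert_varshamov_plus (δ : ℝ) (hδ0 : 0 < δ) (hδ1 : δ < 0.11)
    (n : ℕ) (hn : 2 / (1 / 2 - binaryEntropy δ) < (n : ℝ)) :
    ∃ C : Submodule (ZMod 2) (Fin n → ZMod 2),
      (n : ℝ) / 2 < (Module.finrank (ZMod 2) C : ℝ) ∧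
      (∀ c ∈ C, c ≠ 0 → δ * n ≤ (hammingNorm c : ℝ)) ∧
      (∀ c : Fin n → ZMod 2, (∀ x ∈ C, ∑ i, x i * c i = 0) → c ≠ 0 →
        δ * n ≤ (hammingNorm c : ℝ)) := by
  classical
  have hδ : δ ≤ 1 / 2 := by norm_num at hδ1 ⊢; linarith
  have hH : 0 < 1 / 2 - binaryEntropy δ := sub_pos.2 (binaryEntropy_lt_half hδ0 hδ1)
  have hH0 : 0 ≤ binaryEntropy δ := by
    rw [binaryEntropy_eq_binEntropy_div]
    exact div_nonneg (Real.binEntropy_nonneg hδ0.le (by linarith)) (Real.log_nonneg one_le_two)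
  rw [div_lt_iff₀ hH] at hn
  have hn4 : 4 < n := by
    have : (4 : ℝ) < n := by nlinarith [mul_nonneg (Nat.cast_nonneg (α := ℝ) n) hH0]
    exact_mod_cast this
  obtain ⟨k, hk⟩ : ∃ k, k = n / 2 + 1 := ⟨_, rfl⟩
  obtain ⟨m, rfl⟩ : ∃ m, n = k + m := ⟨n - k, by omega⟩
  have hkn : ((k + m : ℕ) : ℝ) / 2 < k := by
    rw [div_lt_iff₀ two_pos]
    exact_mod_cast (by omega : k + m < k * 2)
  have hkn' : (k : ℝ) ≤ ((k + m : ℕ) : ℝ) / 2 + 1 := by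
    have : k * 2 ≤ k + m + 2 := by omega
    have : (k : ℝ) * 2 ≤ ((k + m : ℕ) : ℝ) + 2 := by exact_mod_cast this
    linarith
  set B : Finset (Fin (k + m) → ZMod 2) :=
    {v | v ≠ 0 ∧ (hammingNorm v : ℝ) < δ * (k + m : ℕ)} with hBdef
  have hBcard : (B.card : ℝ) ≤ 2 ^ (binaryEntropy δ * (k + m : ℕ)) := by
    simpa using card_hammingNorm_lt_le_two_rpow hδ0 hδ B fun v hv => by
      simpa using (Finset.mem_filter.1 hv).2.2.le
  obtain ⟨C, hCdim, hC, hCdual⟩ := exists_submodule_disjoint_dual_disjoint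
    (finSumFinEquiv (m := k) (n := m)) B (by simp [B]) (by
      simp only [ZMod.card, Fintype.card_fin]
      have hm : (m : ℝ) ≤ ((k + m : ℕ) : ℝ) / 2 := by push_cast at hkn ⊢; linarith
      set t : ℝ := ((k + m : ℕ) : ℝ) with ht
      have h2k : (2 : ℝ) ^ k ≤ 2 * 2 ^ (t / 2) := by
        rw [← Real.rpow_natCast, mul_comm, ← Real.rpow_add_one two_ne_zero]
        exact Real.rpow_le_rpow_of_exponent_le one_le_two hkn'
      have h2m : (2 : ℝ) ^ m ≤ 2 ^ (t / 2) := by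
        rw [← Real.rpow_natCast]
        exact Real.rpow_le_rpow_of_exponent_le one_le_two hm
      have hB' : (B.card : ℝ) * 4 ≤ 2 ^ (t / 2) := by
        calc (B.card : ℝ) * 4 ≤ 2 ^ (binaryEntropy δ * t) * 2 ^ (2 : ℝ) := by
              gcongr
              norm_num
          _ = 2 ^ (binaryEntropy δ * t + 2) := (Real.rpow_add two_pos _ _).symm
          _ ≤ 2 ^ (t / 2) := Real.rpow_le_rpow_of_exponent_le one_le_two (by linarith)
      have hsq : (2 : ℝ) ^ (t / 2) * 2 ^ (t / 2) = 2 ^ (k + m) := by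
        rw [← Real.rpow_add two_pos, add_halves, ht, Real.rpow_natCast]
      have hpos : (0 : ℝ) < 2 ^ (t / 2) := by positivity
      have : (B.card : ℝ) * (2 ^ k + 2 ^ m) < 2 ^ (k + m) := by
        calc (B.card : ℝ) * (2 ^ k + 2 ^ m) ≤ B.card * (2 * 2 ^ (t / 2) + 2 ^ (t / 2)) :=
              mul_le_mul_of_nonneg_left (add_le_add h2k h2m) (Nat.cast_nonneg _)
          _ < 2 ^ (k + m) := by rw [← hsq]; nlinarith
      exact_mod_cast this)
  refine ⟨C, by rwa [hCdim, Fintype.card_fin], fun c hc h0 => ?_, fun c hc h0 => ?_⟩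
  · have := hC c hc
    simp only [B, Finset.mem_filter, Finset.mem_univ, true_and, not_and, not_lt] at this
    exact this h0
  · have := hCdual c hc
    simp only [B, Finset.mem_filter, Finset.mem_univ, true_and, not_and, not_lt] at this
    exact this h0
end

section
/- Let k ≤ n be positive natural numbers and δ ∈ (0, 1/2]. The number of matrices G ∈ F₂^{k×n} for which there exists a nonzero vector m ∈ F₂^k with Hamming weight |m·G| < δ·n is at most 2^{kn} · 2^{k − (1−H₂(δ))·n}, where H₂(δ) = −δ·log₂(δ) − (1−δ)·log₂(1−δ). -/
open Finset in
/-- For a nonzero vector `m` over a finite field, `G ↦ m ᵥ* G` is equidistributed: the number of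
matrices mapped into `B` is at most the expected one. -/
theorem card_vecMul_mem_mul_le {K ι κ : Type*} [Field K] [Fintype K] [DecidableEq K]
    [Fintype ι] [DecidableEq ι] [Fintype κ] [DecidableEq κ] {m : ι → K} (hm : m ≠ 0)
    (B : Finset (κ → K)) :
    #{G : Matrix ι κ K | Matrix.vecMul m G ∈ B} * Fintype.card (κ → K) ≤
      #B * Fintype.card (Matrix ι κ K) := by
  obtain ⟨i, hi⟩ := Function.ne_iff.mp hm
  have hsec (y : κ → K) : Matrix.vecMul m (Matrix.vecMulVec (Pi.single i (m i)⁻¹) y) = y := by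
    rw [Matrix.vecMul_vecMulVec, dotProduct_single, mul_inv_cancel₀ hi, one_smul]
  rw [← card_univ, ← card_univ, ← card_product, ← card_product]
  refine card_le_card_of_injOn
    (fun p ↦ (Matrix.vecMul m p.1, p.1 + Matrix.vecMulVec (Pi.single i (m i)⁻¹) p.2)) ?_ ?_
  · rintro ⟨G, y⟩ h
    simpa using h
  · rintro ⟨G, y⟩ - ⟨G', y'⟩ - h
    obtain ⟨h₁, h₂⟩ := Prod.mk.inj h
    have h₃ := congrArg (Matrix.vecMul m) h₂
    simp only [Matrix.vecMul_add, hsec] at h₁ h₃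
    rw [h₁] at h₃
    obtain rfl := add_left_cancel h₃
    exact congrArg (·, y) (add_right_cancel h₂)

theorem two_rpow_neg_binaryEntropy_mul {δ : ℝ} (hδ0 : 0 < δ) (hδ1 : δ < 1) (t : ℝ) :
    (2 : ℝ) ^ (-(binaryEntropy δ * t)) = δ ^ (δ * t) * (1 - δ) ^ ((1 - δ) * t) := by
  have h {x : ℝ} (hx : 0 < x) (s : ℝ) : x ^ s = (2 : ℝ) ^ (Real.logb 2 x * s) := by
    rw [Real.rpow_mul zero_le_two, Real.rpow_logb two_pos (by norm_num) hx]
  rw [h hδ0, h (sub_pos.2 hδ1), ← Real.rpow_add two_pos, binaryEntropy]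
  ring_nf

theorem sum_pow_hammingNorm_mul_pow (n : ℕ) (δ : ℝ) :
    ∑ x : Fin n → ZMod 2, δ ^ hammingNorm x * (1 - δ) ^ (n - hammingNorm x) = 1 := by
  have hx (x : Fin n → ZMod 2) : δ ^ hammingNorm x * (1 - δ) ^ (n - hammingNorm x) =
      ∏ i, if x i ≠ 0 then δ else 1 - δ := by
    rw [Finset.prod_ite, Finset.prod_const, Finset.prod_const, hammingNorm]
    congr 2
    have := Finset.card_filter_add_card_filter_not (s := Finset.univ) (fun i ↦ x i ≠ 0)
    rw [Finset.card_univ, Fintype.card_fin] at this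
    omega
  have hsum : ∑ a : ZMod 2, (if a ≠ 0 then δ else 1 - δ) = 1 := by
    change ∑ a : Fin 2, (if a ≠ 0 then δ else 1 - δ) = 1
    simp [Fin.sum_univ_two]
  simp_rw [hx]
  rw [← Fintype.prod_sum fun (_ : Fin n) (a : ZMod 2) ↦ if a ≠ 0 then δ else 1 - δ]
  simp only [hsum, Finset.prod_const_one]

open Finset in
/-- The entropy bound on the volume of a Hamming ball of relative radius `δ ≤ 1 / 2`. -/
theorem card_hammingNorm_lt_le (n : ℕ) {δ : ℝ} (hδ0 : 0 < δ) (hδ1 : δ ≤ 1 / 2) :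
    (#{x : Fin n → ZMod 2 | (hammingNorm x : ℝ) < δ * n} : ℝ) ≤ 2 ^ (binaryEntropy δ * n) := by
  have hδ' : 0 < 1 - δ := by linarith
  have hterm (x : Fin n → ZMod 2) (hx : (hammingNorm x : ℝ) < δ * n) :
      (2 : ℝ) ^ (-(binaryEntropy δ * n)) ≤ δ ^ hammingNorm x * (1 - δ) ^ (n - hammingNorm x) := by
    have hle : hammingNorm x ≤ n := by simpa using hammingNorm_le_card_fintype (x := x)
    rw [two_rpow_neg_binaryEntropy_mul hδ0 (by linarith), ← Real.rpow_natCast δ,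
      ← Real.rpow_natCast (1 - δ), Nat.cast_sub hle]
    set w : ℝ := (hammingNorm x : ℝ)
    have h₁ : δ ^ (δ * n) = δ ^ w * δ ^ (δ * n - w) := by
      rw [← Real.rpow_add hδ0]; ring_nf
    have h₂ : (1 - δ) ^ ((n : ℝ) - w) = (1 - δ) ^ (δ * n - w) * (1 - δ) ^ ((1 - δ) * n) := by
      rw [← Real.rpow_add hδ']; ring_nf
    rw [h₁, h₂, mul_assoc]
    gcongr
    linarith
  have key : (#{x : Fin n → ZMod 2 | (hammingNorm x : ℝ) < δ * n} : ℝ) *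
      2 ^ (-(binaryEntropy δ * n)) ≤ 1 := by
    rw [← nsmul_eq_mul, ← sum_pow_hammingNorm_mul_pow n δ]
    refine (card_nsmul_le_sum _ _ _ fun x hx ↦ hterm x (mem_filter.1 hx).2).trans ?_
    exact sum_le_sum_of_subset_of_nonneg (filter_subset _ _) fun x _ _ ↦ by positivity
  rwa [Real.rpow_neg zero_le_two, ← div_eq_mul_inv, div_le_one (by positivity)] at key

/-- The number of `k×n` matrices `G` over `F₂` admitting a nonzero message `m` with
`|m·G| < δ·n` is at most `2^{kn} · 2^{k − (1−H₂(δ))·n}`. -/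
theorem count_bad_generator_matrices (k n : ℕ) (hk : 0 < k) (hn : 0 < n) (hkn : k ≤ n)
    (δ : ℝ) (hδ0 : 0 < δ) (hδ1 : δ ≤ 1 / 2) :
    (({G : Matrix (Fin k) (Fin n) (ZMod 2) |
        ∃ m : Fin k → ZMod 2, m ≠ 0 ∧ (hammingNorm (Matrix.vecMul m G) : ℝ) < δ * n} :
          Set (Matrix (Fin k) (Fin n) (ZMod 2))).ncard : ℝ) ≤
      2 ^ (k * n) * 2 ^ ((k : ℝ) - (1 - binaryEntropy δ) * n) := by
  classical
  let B : Finset (Fin n → ZMod 2) := {x | (hammingNorm x : ℝ) < δ * n}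
  let A (m : Fin k → ZMod 2) : Finset (Matrix (Fin k) (Fin n) (ZMod 2)) :=
    {G | Matrix.vecMul m G ∈ B}
  have hA (m : Fin k → ZMod 2) (hm : m ≠ 0) :
      ((A m).card : ℝ) ≤ 2 ^ (k * n) * 2 ^ (binaryEntropy δ * n) / 2 ^ n := by
    have h := card_vecMul_mem_mul_le hm B
    rw [show Fintype.card (Matrix (Fin k) (Fin n) (ZMod 2)) = 2 ^ (k * n) by
        rw [Fintype.card_congr (Matrix.of (m := Fin k) (n := Fin n) (α := ZMod 2)).symm]
        simp [← pow_mul, mul_comm],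
      show Fintype.card (Fin n → ZMod 2) = 2 ^ n by simp] at h
    have h' : ((A m).card : ℝ) * 2 ^ n ≤ B.card * 2 ^ (k * n) := mod_cast h
    rw [le_div_iff₀ (by positivity), mul_comm ((2 : ℝ) ^ (k * n))]
    exact h'.trans (by gcongr; exact card_hammingNorm_lt_le n hδ0 hδ1)
  have hsub : {G : Matrix (Fin k) (Fin n) (ZMod 2) |
      ∃ m : Fin k → ZMod 2, m ≠ 0 ∧ (hammingNorm (Matrix.vecMul m G) : ℝ) < δ * n} ⊆
      ((Finset.univ.erase 0).biUnion A : Finset _) := by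
    rintro G ⟨m, hm, h⟩
    simp only [Finset.coe_biUnion, Set.mem_iUnion]
    exact ⟨m, by simpa using hm, by simpa [A, B] using h⟩
  have hcard : ((Finset.univ.erase (0 : Fin k → ZMod 2)).card : ℝ) ≤ 2 ^ k := by
    have h : (Finset.univ.erase (0 : Fin k → ZMod 2)).card ≤ 2 ^ k :=
      (Finset.card_le_univ _).trans_eq (by simp)
    exact_mod_cast h
  calc _ ≤ (((Finset.univ.erase 0).biUnion A).card : ℝ) := by
        rw [← Set.ncard_coe_finset]
        exact_mod_cast Set.ncard_le_ncard hsub (Finset.finite_toSet _)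
    _ ≤ ∑ m ∈ Finset.univ.erase 0, ((A m).card : ℝ) := mod_cast Finset.card_biUnion_le
    _ ≤ (Finset.univ.erase (0 : Fin k → ZMod 2)).card •
          (2 ^ (k * n) * 2 ^ (binaryEntropy δ * n) / 2 ^ n : ℝ) :=
        Finset.sum_le_card_nsmul _ _ _ fun m hm ↦ hA m (Finset.ne_of_mem_erase hm)
    _ ≤ 2 ^ k * (2 ^ (k * n) * 2 ^ (binaryEntropy δ * n) / 2 ^ n : ℝ) := by
        rw [nsmul_eq_mul]
        gcongr
    _ = _ := by
        rw [show (k : ℝ) - (1 - binaryEntropy δ) * n = k + binaryEntropy δ * n - n by ring,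
          Real.rpow_sub two_pos, Real.rpow_add two_pos, Real.rpow_natCast, Real.rpow_natCast]
        ring
end

section
/- (Künneth formula for fiber bundle complexes) Let B = (B₁ →^{∂^B} B₀) and F = (F₁ →^{∂^F} F₀) be two-term chain complexes of finite-dimensional F₂-vector spaces, with distinguished bases of B₁ and B₀. For each basis vector b¹ of B₁ and each basis vector b⁰ appearing (with coefficient 1) in ∂^B b¹, let φ(b¹,b⁰) be an automorphism of the complex F (a pair of invertible linear maps on F₁ and F₀ commuting with ∂^F), and define the twisted map ∂_φ(b¹ ⊗ f) = Σ_{b⁰ ∈ ∂^B b¹} b⁰ ⊗ φ(b¹,b⁰)(f). Assume each φ(b¹,b⁰) induces the identity on H₁(F) = ker ∂^F and on H₀(F) = coker ∂^F. Let B ⊗_φ F be the total complex B₁⊗F₁ → (B₁⊗F₀) ⊕ (B₀⊗F₁) → B₀⊗F₀ with differentials d₂(x) = ((id⊗∂^F)x, ∂_φ x) and d₁(a,b) = ∂_φ a + (id⊗∂^F)b. Then for each n ∈ {0,1,2}, dim H_n(B ⊗_φ F) = Σ_{p+q=n} dim H_p(B) · dim H_q(F). -/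
section FiberBundle

variable {I J : Type} [Fintype I] [Fintype J] [DecidableEq I] [DecidableEq J]

/-- The twisted (connection) differential `∂_φ(b¹ ⊗ f) = Σ_{b⁰ ∈ ∂B b¹} b⁰ ⊗ φ(b¹,b⁰)(f)`,
written in the distinguished bases `I` of `B₁` and `J` of `B₀`, acting on a fiber `F`. -/
noncomputable def twistedDiff (dB : (I → ZMod 2) →ₗ[ZMod 2] (J → ZMod 2))
    {F : Type} [AddCommGroup F] [Module (ZMod 2) F]
    (φ : I → J → (F ≃ₗ[ZMod 2] F)) :
    (I → F) →ₗ[ZMod 2] (J → F) :=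
  LinearMap.pi fun j =>
    ∑ i : I, dB (Pi.single i 1) j • ((φ i j).toLinearMap.comp (LinearMap.proj i))

variable {F1 F0 : Type} [AddCommGroup F1] [AddCommGroup F0]
  [Module (ZMod 2) F1] [Module (ZMod 2) F0]

/-- Degree-2 differential of the fiber bundle total complex. -/
noncomputable def fbD2 (dB : (I → ZMod 2) →ₗ[ZMod 2] (J → ZMod 2))
    (dF : F1 →ₗ[ZMod 2] F0)
    (φ1 : I → J → (F1 ≃ₗ[ZMod 2] F1)) :
    (I → F1) →ₗ[ZMod 2] (I → F0) × (J → F1) :=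
  LinearMap.prod (LinearMap.compLeft dF I) (twistedDiff dB φ1)

/-- Degree-1 differential of the fiber bundle total complex. -/
noncomputable def fbD1 (dB : (I → ZMod 2) →ₗ[ZMod 2] (J → ZMod 2))
    (dF : F1 →ₗ[ZMod 2] F0)
    (φ0 : I → J → (F0 ≃ₗ[ZMod 2] F0)) :
    (I → F0) × (J → F1) →ₗ[ZMod 2] (J → F0) :=
  (twistedDiff dB φ0).comp (LinearMap.fst (ZMod 2) (I → F0) (J → F1)) +
    (LinearMap.compLeft dF J).comp (LinearMap.snd (ZMod 2) (I → F0) (J → F1))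

/-- Coordinatewise application of a linear map intertwines the untwisted differentials. -/
lemma twistedDiff_refl_compLeft {ι κ : Type} [Fintype ι] [DecidableEq ι]
    {V W : Type} [AddCommGroup V] [AddCommGroup W]
    [Module (ZMod 2) V] [Module (ZMod 2) W]
    (dB : (ι → ZMod 2) →ₗ[ZMod 2] (κ → ZMod 2)) (g : V →ₗ[ZMod 2] W) (x : ι → V) (j : κ) :
    twistedDiff dB (fun _ _ => LinearEquiv.refl (ZMod 2) W) (fun i => g (x i)) j =
      g (twistedDiff dB (fun _ _ => LinearEquiv.refl (ZMod 2) V) x j) := by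
  simp [twistedDiff]

lemma twistedDiff_refl_eq {ι κ : Type} [Fintype ι] [DecidableEq ι]
    (dB : (ι → ZMod 2) →ₗ[ZMod 2] (κ → ZMod 2)) :
    twistedDiff dB (fun _ _ => LinearEquiv.refl (ZMod 2) (ZMod 2)) = dB := by
  refine LinearMap.pi_ext' fun i => LinearMap.ext_ring ?_
  ext j
  simp [twistedDiff, Pi.single_apply]

/-- The kernel of the untwisted differential is `ker dB ⊗ V`. -/
lemma finrank_ker_twistedDiff_refl {ι κ : Type} [Fintype ι] [DecidableEq ι]
    (dB : (ι → ZMod 2) →ₗ[ZMod 2] (κ → ZMod 2))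
    (V : Type) [AddCommGroup V] [Module (ZMod 2) V] [FiniteDimensional (ZMod 2) V] :
    Module.finrank (ZMod 2)
        (LinearMap.ker (twistedDiff dB (fun _ _ => LinearEquiv.refl (ZMod 2) V))) =
      Module.finrank (ZMod 2) (LinearMap.ker dB) * Module.finrank (ZMod 2) V := by
  let b := Module.finBasis (ZMod 2) V
  have coord (x : ι → V) (k) (j : κ) : dB (fun i => b.coord k (x i)) j =
      b.coord k (twistedDiff dB (fun _ _ => LinearEquiv.refl (ZMod 2) V) x j) := by
    rw [← twistedDiff_refl_compLeft, twistedDiff_refl_eq]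
  have mem_ker (x : ι → V) :
      x ∈ LinearMap.ker (twistedDiff dB (fun _ _ => LinearEquiv.refl (ZMod 2) V)) ↔
        ∀ k, (fun i => b.coord k (x i)) ∈ LinearMap.ker dB := by
    simp only [LinearMap.mem_ker, funext_iff, coord, Pi.zero_apply]
    rw [forall_comm]
    exact forall_congr' fun j => b.forall_coord_eq_zero_iff.symm
  let e : LinearMap.ker (twistedDiff dB (fun _ _ => LinearEquiv.refl (ZMod 2) V)) ≃ₗ[ZMod 2]
      (Fin (Module.finrank (ZMod 2) V) → LinearMap.ker dB) :=
    { toFun := fun x k => ⟨fun i => b.coord k (x.1 i), (mem_ker x.1).1 x.2 k⟩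
      map_add' := fun x y => by ext; simp
      map_smul' := fun c x => by ext; simp
      invFun := fun y => ⟨fun i => b.equivFun.symm fun k => (y k).1 i, (mem_ker _).2 fun k => by
        convert (y k).2 using 2
        exact congrFun (b.equivFun.apply_symm_apply fun k => (y k).1 _) k⟩
      left_inv := fun x => by
        ext i
        exact b.equivFun.symm_apply_apply (x.1 i)
      right_inv := fun y => by
        ext k i
        exact congrFun (b.equivFun.apply_symm_apply fun k => (y k).1 i) k }
  rw [e.finrank_eq, Module.finrank_pi_fintype]
  simp [mul_comm]

/-- The cokernel of the untwisted differential is `coker dB ⊗ V`. -/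
lemma finrank_coker_twistedDiff_refl {ι κ : Type} [Fintype ι] [Fintype κ] [DecidableEq ι]
    (dB : (ι → ZMod 2) →ₗ[ZMod 2] (κ → ZMod 2))
    (V : Type) [AddCommGroup V] [Module (ZMod 2) V] [FiniteDimensional (ZMod 2) V] :
    Module.finrank (ZMod 2)
        ((κ → V) ⧸ LinearMap.range (twistedDiff dB (fun _ _ => LinearEquiv.refl (ZMod 2) V))) =
      Module.finrank (ZMod 2) ((κ → ZMod 2) ⧸ LinearMap.range dB) *
        Module.finrank (ZMod 2) V := by
  have hker := finrank_ker_twistedDiff_refl dB V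
  have hT := (twistedDiff dB (fun _ _ => LinearEquiv.refl (ZMod 2) V)).finrank_range_add_finrank_ker
  have hB := dB.finrank_range_add_finrank_ker
  have hTq := (LinearMap.range
    (twistedDiff dB (fun _ _ => LinearEquiv.refl (ZMod 2) V))).finrank_quotient_add_finrank
  have hBq := (LinearMap.range dB).finrank_quotient_add_finrank
  simp only [Module.finrank_pi_fintype, Module.finrank_self, Finset.sum_const, Finset.card_univ,
    smul_eq_mul, mul_one] at hT hB hTq hBq
  rw [← hB] at hT
  rw [← hBq] at hTq
  linarith

lemma finrank_ker_fbD2 {ι κ : Type} [Fintype ι] [DecidableEq ι]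
    [FiniteDimensional (ZMod 2) F1]
    {dB : (ι → ZMod 2) →ₗ[ZMod 2] (κ → ZMod 2)} {dF : F1 →ₗ[ZMod 2] F0}
    {φ1 : ι → κ → (F1 ≃ₗ[ZMod 2] F1)}
    (hφH1 : ∀ i j, ∀ f ∈ LinearMap.ker dF, φ1 i j f = f) :
    Module.finrank (ZMod 2) (LinearMap.ker (fbD2 dB dF φ1)) =
      Module.finrank (ZMod 2) (LinearMap.ker dB) *
        Module.finrank (ZMod 2) (LinearMap.ker dF) := by
  let incl := (LinearMap.ker dF).subtype.compLeft ι
  have hincl : Function.Injective incl := (LinearMap.ker dF).injective_subtype.comp_left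
  have twisted_eq (y : ι → LinearMap.ker dF) (j : κ) : twistedDiff dB φ1 (incl y) j =
      (twistedDiff dB (fun _ _ => LinearEquiv.refl (ZMod 2) (LinearMap.ker dF)) y j : F1) := by
    simp [twistedDiff, incl, hφH1 _ j _ (y _).2]
  have hmap : (LinearMap.ker (twistedDiff dB
      (fun _ _ => LinearEquiv.refl (ZMod 2) (LinearMap.ker dF)))).map incl =
        LinearMap.ker (fbD2 dB dF φ1) := by
    ext x
    simp only [Submodule.mem_map, LinearMap.mem_ker, fbD2, LinearMap.prod_apply,
      Function.prod, Prod.mk_eq_zero]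
    constructor
    · rintro ⟨y, hy, rfl⟩
      refine ⟨funext fun i => (y i).2, funext fun j => ?_⟩
      simp [twisted_eq, hy]
    · rintro ⟨hx, hT⟩
      refine ⟨fun i => ⟨x i, congrFun hx i⟩, funext fun j => Subtype.ext ?_, rfl⟩
      rw [← twisted_eq]
      exact congrFun hT j
  rw [← hmap, ← finrank_ker_twistedDiff_refl,
    ((LinearMap.ker (twistedDiff dB _)).equivMapOfInjective incl hincl).finrank_eq]

lemma finrank_coker_fbD1 {ι κ : Type} [Fintype ι] [Fintype κ] [DecidableEq ι]
    [FiniteDimensional (ZMod 2) F0]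
    {dB : (ι → ZMod 2) →ₗ[ZMod 2] (κ → ZMod 2)} {dF : F1 →ₗ[ZMod 2] F0}
    {φ0 : ι → κ → (F0 ≃ₗ[ZMod 2] F0)}
    (hφH0 : ∀ i j, ∀ f : F0, φ0 i j f - f ∈ LinearMap.range dF) :
    Module.finrank (ZMod 2) ((κ → F0) ⧸ LinearMap.range (fbD1 dB dF φ0)) =
      Module.finrank (ZMod 2) ((κ → ZMod 2) ⧸ LinearMap.range dB) *
        Module.finrank (ZMod 2) (F0 ⧸ LinearMap.range dF) := by
  let T := twistedDiff dB (fun _ _ => LinearEquiv.refl (ZMod 2) (F0 ⧸ LinearMap.range dF))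
  let q : (κ → F0) →ₗ[ZMod 2] (κ → F0 ⧸ LinearMap.range dF) :=
    (LinearMap.range dF).mkQ.compLeft κ
  have hq : Function.Surjective q := (LinearMap.range dF).mkQ_surjective.comp_left
  have q_twisted (a : ι → F0) :
      q (twistedDiff dB φ0 a) = T (fun i => (LinearMap.range dF).mkQ (a i)) := by
    ext j
    have h (i : ι) : (LinearMap.range dF).mkQ (φ0 i j (a i)) = (LinearMap.range dF).mkQ (a i) :=
      (Submodule.Quotient.eq _).2 (hφH0 i j (a i))
    simp only [q, T, twistedDiff, LinearMap.compLeft_apply, Function.comp_apply,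
      LinearMap.pi_apply, LinearMap.sum_apply, LinearMap.smul_apply, LinearMap.comp_apply,
      LinearMap.proj_apply, LinearEquiv.coe_coe, map_sum, map_smul, h, LinearEquiv.refl_apply]
  have ker_q (z : κ → F0) : q z = 0 ↔ ∃ b : κ → F1, dF.compLeft κ b = z := by
    simp only [q, funext_iff, LinearMap.compLeft_apply, Function.comp_apply, Pi.zero_apply,
      Submodule.mkQ_apply, Submodule.Quotient.mk_eq_zero, LinearMap.mem_range]
    exact Classical.skolem
  have hker : LinearMap.ker ((LinearMap.range T).mkQ.comp q) =
      LinearMap.range (fbD1 dB dF φ0) := by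
    ext z
    simp only [LinearMap.mem_ker, LinearMap.comp_apply, Submodule.mkQ_apply,
      Submodule.Quotient.mk_eq_zero, LinearMap.mem_range, fbD1, LinearMap.add_apply, Prod.exists,
      LinearMap.fst_apply, LinearMap.snd_apply]
    constructor
    · rintro ⟨y, hy⟩
      obtain ⟨a, rfl⟩ := (LinearMap.range dF).mkQ_surjective.comp_left y
      obtain ⟨b, hb⟩ := (ker_q (z - twistedDiff dB φ0 a)).1
        (by rw [map_sub, q_twisted, ← hy, sub_eq_zero]; rfl)
      exact ⟨a, b, by rw [hb, add_sub_cancel]⟩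
    · rintro ⟨a, b, rfl⟩
      exact ⟨fun i => (LinearMap.range dF).mkQ (a i), by
        rw [map_add, (ker_q _).2 ⟨b, rfl⟩, add_zero, q_twisted]⟩
  rw [← hker, ← finrank_coker_twistedDiff_refl]
  exact (LinearMap.quotKerEquivOfSurjective ((LinearMap.range T).mkQ.comp q)
    ((LinearMap.range T).mkQ_surjective.comp hq)).finrank_eq

lemma range_fbD2_le_ker_fbD1 {ι κ : Type} [Fintype ι] [DecidableEq ι]
    {dB : (ι → ZMod 2) →ₗ[ZMod 2] (κ → ZMod 2)} {dF : F1 →ₗ[ZMod 2] F0}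
    {φ1 : ι → κ → (F1 ≃ₗ[ZMod 2] F1)} {φ0 : ι → κ → (F0 ≃ₗ[ZMod 2] F0)}
    (hφ : ∀ i j, dF.comp (φ1 i j).toLinearMap = (φ0 i j).toLinearMap.comp dF) :
    LinearMap.range (fbD2 dB dF φ1) ≤ LinearMap.ker (fbD1 dB dF φ0) := by
  rintro _ ⟨x, rfl⟩
  have h (i j) : dF (φ1 i j (x i)) = φ0 i j (dF (x i)) := LinearMap.congr_fun (hφ i j) (x i)
  have two_eq_zero (f : F0) : f + f = 0 := by
    rw [← two_smul (ZMod 2) f, show (2 : ZMod 2) = 0 from rfl, zero_smul]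
  ext j
  simp [fbD1, fbD2, twistedDiff, h, two_eq_zero]

/-- Künneth formula for fiber bundle complexes: if the connection `φ` acts as the
identity on the homology of the fiber `F`, then the homology of `B ⊗_φ F` has the
dimensions predicted by the Künneth formula. -/
theorem kuenneth_fiber_bundle
    [FiniteDimensional (ZMod 2) F1] [FiniteDimensional (ZMod 2) F0]
    (dB : (I → ZMod 2) →ₗ[ZMod 2] (J → ZMod 2))
    (dF : F1 →ₗ[ZMod 2] F0)
    (φ1 : I → J → (F1 ≃ₗ[ZMod 2] F1)) (φ0 : I → J → (F0 ≃ₗ[ZMod 2] F0))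
    (hφ : ∀ i j, dF.comp (φ1 i j).toLinearMap = (φ0 i j).toLinearMap.comp dF)
    (hφH1 : ∀ i j, ∀ f ∈ LinearMap.ker dF, φ1 i j f = f)
    (hφH0 : ∀ i j, ∀ f : F0, φ0 i j f - f ∈ LinearMap.range dF) :
    Module.finrank (ZMod 2) (LinearMap.ker (fbD2 dB dF φ1)) =
        Module.finrank (ZMod 2) (LinearMap.ker dB) *
          Module.finrank (ZMod 2) (LinearMap.ker dF) ∧
    Module.finrank (ZMod 2)
        (↥(LinearMap.ker (fbD1 dB dF φ0)) ⧸
          (LinearMap.range (fbD2 dB dF φ1)).comap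
            (LinearMap.ker (fbD1 dB dF φ0)).subtype) =
      Module.finrank (ZMod 2) (LinearMap.ker dB) *
          Module.finrank (ZMod 2) (F0 ⧸ LinearMap.range dF) +
        Module.finrank (ZMod 2) ((J → ZMod 2) ⧸ LinearMap.range dB) *
          Module.finrank (ZMod 2) (LinearMap.ker dF) ∧
    Module.finrank (ZMod 2) ((J → F0) ⧸ LinearMap.range (fbD1 dB dF φ0)) =
      Module.finrank (ZMod 2) ((J → ZMod 2) ⧸ LinearMap.range dB) *
        Module.finrank (ZMod 2) (F0 ⧸ LinearMap.range dF) := by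
  have h2 := finrank_ker_fbD2 (dB := dB) hφH1
  have h0 := finrank_coker_fbD1 (dB := dB) hφH0
  refine ⟨h2, ?_, h0⟩
  have hH1 := ((LinearMap.range (fbD2 dB dF φ1)).comap
    (LinearMap.ker (fbD1 dB dF φ0)).subtype).finrank_quotient_add_finrank
  rw [(Submodule.comapSubtypeEquivOfLe (range_fbD2_le_ker_fbD1 hφ)).finrank_eq] at hH1
  have hd2 := (fbD2 dB dF φ1).finrank_range_add_finrank_ker
  have hd1 := (fbD1 dB dF φ0).finrank_range_add_finrank_ker
  have hq1 := (LinearMap.range (fbD1 dB dF φ0)).finrank_quotient_add_finrank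
  have hB := dB.finrank_range_add_finrank_ker
  have hBq := (LinearMap.range dB).finrank_quotient_add_finrank
  have hF := dF.finrank_range_add_finrank_ker
  have hFq := (LinearMap.range dF).finrank_quotient_add_finrank
  simp only [Module.finrank_prod, Module.finrank_pi_fintype, Module.finrank_self,
    Finset.sum_const, Finset.card_univ, smul_eq_mul, mul_one] at hd2 hd1 hq1 hB hBq
  rw [h2, ← hB, ← hF] at hd2
  rw [h0, ← hBq, ← hFq] at hq1
  rw [← hB, ← hBq, ← hF, ← hFq] at hd1
  linarith

end FiberBundle
end

section
/- Let B = (B₁ →^{∂^B} B₀) and F = (F₁ →^{∂^F} F₀) be two-term complexes of finite-dimensional F₂-vector spaces with a connection φ (as in a fiber bundle complex B ⊗_φ F) such that each φ(b¹,b⁰) induces the identity on H₁(F) and H₀(F). Suppose further there is a linear map ε : F₀ → F₂ with ε ∘ ∂^F = 0 which induces an isomorphism coker ∂^F ≅ F₂, and that ∂^B is surjective (H₀(B) = 0). Then the map π_* on degree-1 chains of B ⊗_φ F, defined by π_*(u, v) = (id_{B₁} ⊗ ε)(u) for u ∈ B₁⊗F₀ and v ∈ B₀⊗F₁, induces an isomorphism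 H₁(B ⊗_φ F) ≅ H₁(B); dually, its transpose π^* induces an isomorphism H¹(B) ≅ H¹(B ⊗_φ F) on cohomology (kernels modulo images of the transposed differentials). -/
section FiberBundle

variable {I J : Type} [Fintype I] [Fintype J] [DecidableEq I] [DecidableEq J]

variable {F1 F0 : Type} [AddCommGroup F1] [AddCommGroup F0]
  [Module (ZMod 2) F1] [Module (ZMod 2) F0]

/-- The projection `π_*` onto base chains: `π_*(u, v) = (id_{B₁} ⊗ ε)(u)`. -/
noncomputable def fbProj (ε : F0 →ₗ[ZMod 2] ZMod 2) :
    (I → F0) × (J → F1) →ₗ[ZMod 2] (I → ZMod 2) :=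
  (LinearMap.compLeft ε I).comp (LinearMap.fst (ZMod 2) (I → F0) (J → F1))

/-- A surjective linear map with kernel `p` induces an isomorphism from the quotient by `p`. -/
theorem LinearMap.exists_quotient_equiv {K M N : Type*} [Ring K] [AddCommGroup M]
    [AddCommGroup N] [Module K M] [Module K N] (g : M →ₗ[K] N) (hg : Function.Surjective g)
    (p : Submodule K M) (hp : LinearMap.ker g = p) :
    ∃ e : (M ⧸ p) ≃ₗ[K] N, ∀ x, e (Submodule.Quotient.mk x) = g x := by
  subst hp
  exact ⟨g.quotKerEquivOfSurjective hg, fun _ => rfl⟩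

section DegreeOne

variable {C2 C1 C0 B1 B0 : Type*} [AddCommGroup C2] [AddCommGroup C1]
  [AddCommGroup C0] [AddCommGroup B1] [AddCommGroup B0] [Module (ZMod 2) C2] [Module (ZMod 2) C1]
  [Module (ZMod 2) C0] [Module (ZMod 2) B1] [Module (ZMod 2) B0]

/-- A functional is a coboundary iff it vanishes on cycles. -/
theorem LinearMap.mem_range_dualMap_iff (d : C1 →ₗ[ZMod 2] C0) (y : Module.Dual (ZMod 2) C1) :
    y ∈ LinearMap.range d.dualMap ↔ ∀ x, d x = 0 → y x = 0 := by
  rw [LinearMap.range_dualMap_eq_dualAnnihilator_ker, Submodule.mem_dualAnnihilator]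
  rfl

/-- A map on degree-1 chains sending cycles onto cycles, with exactly the boundaries as its kernel
on cycles, induces an isomorphism on degree-1 homology. -/
theorem exists_homology_equiv (d2 : C2 →ₗ[ZMod 2] C1) (d1 : C1 →ₗ[ZMod 2] C0) (dB : B1 →ₗ[ZMod 2] B0)
    (p : C1 →ₗ[ZMod 2] B1) (hpd2 : ∀ w, p (d2 w) = 0)
    (hcycle : ∀ x, d1 x = 0 → dB (p x) = 0)
    (hlift : ∀ z, dB z = 0 → ∃ x, d1 x = 0 ∧ p x = z)
    (hker : ∀ x, d1 x = 0 → p x = 0 → ∃ w, d2 w = x) :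
    ∃ e : (↥(LinearMap.ker d1) ⧸ (LinearMap.range d2).comap (LinearMap.ker d1).subtype) ≃ₗ[ZMod 2]
        ↥(LinearMap.ker dB),
      ∀ (x : ↥(LinearMap.ker d1)) (z : ↥(LinearMap.ker dB)),
        (z : B1) = p x → e (Submodule.Quotient.mk x) = z := by
  obtain ⟨e, he⟩ := LinearMap.exists_quotient_equiv
    (p.restrict (p := LinearMap.ker d1) (q := LinearMap.ker dB) hcycle)
    (fun z => by
      obtain ⟨x, hx, hxz⟩ := hlift z z.2
      exact ⟨⟨x, hx⟩, Subtype.ext hxz⟩)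
    ((LinearMap.range d2).comap (LinearMap.ker d1).subtype)
    (by
      ext ⟨x, hx⟩
      constructor
      · intro h
        exact hker x hx (congrArg Subtype.val h)
      · rintro ⟨w, hw⟩
        have hw' : d2 w = x := hw
        subst hw'
        exact Subtype.ext (hpd2 w))
  refine ⟨e, fun x z h => ?_⟩
  rw [he]
  exact Subtype.ext h.symm

/-- The transpose of a map as in `exists_homology_equiv` induces an isomorphism on degree-1
cohomology. -/
theorem exists_cohomology_equiv (d2 : C2 →ₗ[ZMod 2] C1) (d1 : C1 →ₗ[ZMod 2] C0) (dB : B1 →ₗ[ZMod 2] B0)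
    (p : C1 →ₗ[ZMod 2] B1) (hpd2 : ∀ w, p (d2 w) = 0)
    (hcycle : ∀ x, d1 x = 0 → dB (p x) = 0)
    (hlift : ∀ z, dB z = 0 → ∃ x, d1 x = 0 ∧ p x = z)
    (hker : ∀ x, d1 x = 0 → p x = 0 → ∃ w, d2 w = x) :
    ∃ e : (Module.Dual (ZMod 2) B1 ⧸ LinearMap.range dB.dualMap) ≃ₗ[ZMod 2]
        (↥(LinearMap.ker d2.dualMap) ⧸
          ((LinearMap.range d1.dualMap).comap (LinearMap.ker d2.dualMap).subtype :
            Submodule (ZMod 2) ↥(LinearMap.ker d2.dualMap))),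
      ∀ (ψ : Module.Dual (ZMod 2) B1) (y : ↥(LinearMap.ker d2.dualMap)),
        (y : Module.Dual (ZMod 2) C1) = p.dualMap ψ →
        e (Submodule.Quotient.mk ψ) = Submodule.Quotient.mk y := by
  have hcocycle : ∀ ψ, p.dualMap ψ ∈ LinearMap.ker d2.dualMap := fun ψ => by
    ext w
    simp [hpd2]
  have hclass : ∀ y ∈ LinearMap.ker d2.dualMap,
      ∃ ψ, p.dualMap ψ - y ∈ LinearMap.range d1.dualMap := by
    intro y hy
    obtain ⟨s, hs⟩ := (p.restrict (p := LinearMap.ker d1) (q := LinearMap.ker dB)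
      hcycle).exists_rightInverse_of_surjective (LinearMap.range_eq_top.2 fun z => by
        obtain ⟨x, hx, hxz⟩ := hlift z z.2
        exact ⟨⟨x, hx⟩, Subtype.ext hxz⟩)
    obtain ⟨ψ, hψ⟩ := LinearMap.exists_extend (y.comp ((LinearMap.ker d1).subtype.comp s))
    refine ⟨ψ, (LinearMap.mem_range_dualMap_iff d1 _).2 fun x hx => ?_⟩
    have hψx : ψ (p x) = y (s ⟨p x, hcycle x hx⟩) :=
      LinearMap.congr_fun hψ ⟨p x, hcycle x hx⟩
    have hsx : p (s ⟨p x, hcycle x hx⟩) = p x :=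
      congrArg Subtype.val (LinearMap.congr_fun hs ⟨p x, hcycle x hx⟩)
    obtain ⟨w, hw⟩ := hker (s ⟨p x, hcycle x hx⟩ - x)
      (by rw [map_sub, hx, sub_zero]; exact (s _).2) (by rw [map_sub, hsx, sub_self])
    have hyw : y (d2 w) = 0 := LinearMap.congr_fun hy w
    rw [hw, map_sub] at hyw
    change ψ (p x) - y x = 0
    rw [hψx, hyw]
  have hexact : ∀ ψ, p.dualMap ψ ∈ LinearMap.range d1.dualMap ↔
      ψ ∈ LinearMap.range dB.dualMap := by
    intro ψ
    rw [LinearMap.mem_range_dualMap_iff, LinearMap.mem_range_dualMap_iff]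
    constructor
    · intro h z hz
      obtain ⟨x, hx, rfl⟩ := hlift z hz
      exact h x hx
    · intro h x hx
      exact h _ (hcycle x hx)
  let N : Submodule (ZMod 2) ↥(LinearMap.ker d2.dualMap) :=
    (LinearMap.range d1.dualMap).comap (LinearMap.ker d2.dualMap).subtype
  let g : Module.Dual (ZMod 2) B1 →ₗ[ZMod 2] (↥(LinearMap.ker d2.dualMap) ⧸ N) :=
    N.mkQ.comp (p.dualMap.codRestrict (LinearMap.ker d2.dualMap) hcocycle)
  have hg : Function.Surjective g := by
    intro q
    obtain ⟨y, rfl⟩ := N.mkQ_surjective q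
    obtain ⟨ψ, hψ⟩ := hclass y y.2
    exact ⟨ψ, (Submodule.Quotient.eq N).2 hψ⟩
  obtain ⟨e, he⟩ := LinearMap.exists_quotient_equiv g hg (LinearMap.range dB.dualMap) (by
    ext ψ
    exact (Submodule.Quotient.mk_eq_zero N).trans (hexact ψ))
  refine ⟨e, fun ψ y h => (he ψ).trans ?_⟩
  exact congrArg N.mkQ (Subtype.ext h.symm)

end DegreeOne

theorem twistedDiff_apply {I J : Type} [Fintype I] [DecidableEq I]
    (dB : (I → ZMod 2) →ₗ[ZMod 2] (J → ZMod 2))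
    {F : Type} [AddCommGroup F] [Module (ZMod 2) F] (φ : I → J → (F ≃ₗ[ZMod 2] F))
    (u : I → F) (j : J) :
    twistedDiff dB φ u j = ∑ i, dB (Pi.single i 1) j • φ i j (u i) := by
  simp [twistedDiff]

/-- A functional invariant under the connection intertwines the twisted differential with `dB`. -/
theorem apply_twistedDiff {I J : Type} [Fintype I] [DecidableEq I]
    (dB : (I → ZMod 2) →ₗ[ZMod 2] (J → ZMod 2))
    {F : Type} [AddCommGroup F] [Module (ZMod 2) F] (φ : I → J → (F ≃ₗ[ZMod 2] F))
    (ε : F →ₗ[ZMod 2] ZMod 2) (hε : ∀ i j f, ε (φ i j f) = ε f) (u : I → F) (j : J) :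
    ε (twistedDiff dB φ u j) = dB (fun i => ε (u i)) j := by
  have hsum : dB (fun i => ε (u i)) = ∑ i, ε (u i) • dB (Pi.single i 1) := by
    conv_lhs => rw [pi_eq_sum_univ' (fun i => ε (u i))]
    simp only [map_sum, map_smul]
  rw [twistedDiff_apply, hsum]
  simp [hε, mul_comm]

/-- Over a surjective `dB`, chains valued in a submodule fixed by the connection are twisted
boundaries of such chains. -/
theorem exists_twistedDiff_eq (dB : (I → ZMod 2) →ₗ[ZMod 2] (J → ZMod 2))
    (hB0 : Function.Surjective dB)
    {F : Type} [AddCommGroup F] [Module (ZMod 2) F] (φ : I → J → (F ≃ₗ[ZMod 2] F))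
    (N : Submodule (ZMod 2) F) (hN : ∀ i j, ∀ f ∈ N, φ i j f = f)
    (c : J → F) (hc : ∀ j, c j ∈ N) :
    ∃ k : I → F, (∀ i, k i ∈ N) ∧ twistedDiff dB φ k = c := by
  choose s hs using fun j : J => hB0 (Pi.single j 1)
  have hk : ∀ i, ∑ j, s j i • c j ∈ N := fun i =>
    N.sum_mem fun j _ => N.smul_mem _ (hc j)
  refine ⟨fun i => ∑ j, s j i • c j, hk, ?_⟩
  ext j
  have hcoef : ∀ j', ∑ i, dB (Pi.single i 1) j * s j' i = (Pi.single j' 1 : J → ZMod 2) j := by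
    intro j'
    have h := apply_twistedDiff dB (fun _ _ => LinearEquiv.refl (ZMod 2) (ZMod 2))
      LinearMap.id (fun _ _ _ => rfl) (s j') j
    simpa [twistedDiff_apply, hs] using h
  simp only [twistedDiff_apply, hN _ _ _ (hk _), Finset.smul_sum, smul_smul]
  rw [Finset.sum_comm]
  simp [← Finset.sum_smul, hcoef, Pi.single_apply]

/-- If the connection acts trivially on the homology of the fiber, the augmentation
induces an isomorphism `H₀(F) ≅ F₂`, and `H₀(B) = 0`, then `π_*` induces an isomorphism
`H₁(B ⊗_φ F) ≅ H₁(B)` and its transpose `π^*` induces `H¹(B) ≅ H¹(B ⊗_φ F)`. -/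
theorem fiber_bundle_projection_iso
    [FiniteDimensional (ZMod 2) F1] [FiniteDimensional (ZMod 2) F0]
    (dB : (I → ZMod 2) →ₗ[ZMod 2] (J → ZMod 2))
    (dF : F1 →ₗ[ZMod 2] F0)
    (φ1 : I → J → (F1 ≃ₗ[ZMod 2] F1)) (φ0 : I → J → (F0 ≃ₗ[ZMod 2] F0))
    (hφ : ∀ i j, dF.comp (φ1 i j).toLinearMap = (φ0 i j).toLinearMap.comp dF)
    (hφH1 : ∀ i j, ∀ f ∈ LinearMap.ker dF, φ1 i j f = f)
    (hφH0 : ∀ i j, ∀ f : F0, φ0 i j f - f ∈ LinearMap.range dF)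
    (ε : F0 →ₗ[ZMod 2] ZMod 2)
    (hεd : ∀ f : F1, ε (dF f) = 0)
    (hεsurj : Function.Surjective ε)
    (hεker : LinearMap.ker ε = LinearMap.range dF)
    (hB0 : Function.Surjective dB) :
    (∃ e : (↥(LinearMap.ker (fbD1 dB dF φ0)) ⧸
          (LinearMap.range (fbD2 dB dF φ1)).comap
            (LinearMap.ker (fbD1 dB dF φ0)).subtype) ≃ₗ[ZMod 2]
          ↥(LinearMap.ker dB),
        ∀ (x : ↥(LinearMap.ker (fbD1 dB dF φ0))) (z : ↥(LinearMap.ker dB)),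
          (z : I → ZMod 2) = fbProj ε (x : (I → F0) × (J → F1)) →
          e (Submodule.Quotient.mk x) = z) ∧
    (∃ e' : (Module.Dual (ZMod 2) (I → ZMod 2) ⧸ LinearMap.range dB.dualMap) ≃ₗ[ZMod 2]
          (↥(LinearMap.ker (fbD2 dB dF φ1).dualMap) ⧸
            ((LinearMap.range (fbD1 dB dF φ0).dualMap).comap
              (LinearMap.ker (fbD2 dB dF φ1).dualMap).subtype :
              Submodule (ZMod 2) ↥(LinearMap.ker (fbD2 dB dF φ1).dualMap))),
        ∀ (ψ : Module.Dual (ZMod 2) (I → ZMod 2))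
          (y : ↥(LinearMap.ker (fbD2 dB dF φ1).dualMap)),
          (y : Module.Dual (ZMod 2) ((I → F0) × (J → F1))) = (fbProj ε).dualMap ψ →
          e' (Submodule.Quotient.mk ψ) = Submodule.Quotient.mk y) := by
  have hεφ : ∀ i j f, ε (φ0 i j f) = ε f := fun i j f => by
    have h := hφH0 i j f
    rwa [← hεker, LinearMap.mem_ker, map_sub, sub_eq_zero] at h
  have hexact : ∀ f, ε f = 0 → ∃ g, dF g = f := fun f hf => by
    have h : f ∈ LinearMap.ker ε := hf
    rwa [hεker] at h
  have hT : ∀ w j, twistedDiff dB φ0 (fun i => dF (w i)) j = dF (twistedDiff dB φ1 w j) := by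
    intro w j
    simp only [twistedDiff_apply, map_sum, map_smul]
    exact Finset.sum_congr rfl fun i _ =>
      congrArg _ (LinearMap.congr_fun (hφ i j) (w i)).symm
  have hd1 : ∀ u v j, fbD1 dB dF φ0 (u, v) j = twistedDiff dB φ0 u j + dF (v j) :=
    fun _ _ _ => rfl
  have hpd2 : ∀ w, fbProj ε (fbD2 dB dF φ1 w) = 0 := fun w => funext fun i => hεd (w i)
  have hcycle : ∀ x, fbD1 dB dF φ0 x = 0 → dB (fbProj ε x) = 0 := by
    rintro ⟨u, v⟩ h
    ext j
    have hj := congrArg ε (congrFun h j)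
    rw [hd1, map_add, hεd, add_zero, apply_twistedDiff dB φ0 ε hεφ, Pi.zero_apply, map_zero] at hj
    exact hj
  have hlift : ∀ z, dB z = 0 → ∃ x, fbD1 dB dF φ0 x = 0 ∧ fbProj ε x = z := by
    intro z hz
    choose u hu using fun i => hεsurj (z i)
    have hTu : ∀ j, ∃ g, dF g = twistedDiff dB φ0 u j := fun j => hexact _ <| by
      rw [apply_twistedDiff dB φ0 ε hεφ, funext hu, hz]
      rfl
    choose v hv using hTu
    refine ⟨(u, -v), funext fun j => ?_, funext hu⟩
    rw [hd1, Pi.neg_apply, map_neg, hv, add_neg_cancel]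
    rfl
  have hker : ∀ x, fbD1 dB dF φ0 x = 0 → fbProj ε x = 0 → ∃ w, fbD2 dB dF φ1 w = x := by
    rintro ⟨u, v⟩ h hp
    choose w hw using fun i => hexact (u i) (congrFun hp i)
    obtain rfl : (fun i => dF (w i)) = u := funext hw
    obtain ⟨k, hkN, hk⟩ := exists_twistedDiff_eq dB hB0 φ1 (LinearMap.ker dF) hφH1
      (v - twistedDiff dB φ1 w) (fun j => by
        have hj := congrFun h j
        rw [hd1, hT, Pi.zero_apply] at hj
        rw [LinearMap.mem_ker, Pi.sub_apply, map_sub, eq_neg_of_add_eq_zero_right hj,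
          ZModModule.neg_eq_self, sub_self])
    refine ⟨w + k, Prod.ext (funext fun i => ?_) ?_⟩
    · change dF (w i + k i) = dF (w i)
      rw [map_add, LinearMap.mem_ker.1 (hkN i), add_zero]
    · change twistedDiff dB φ1 (w + k) = v
      rw [map_add, hk, add_sub_cancel]
  exact ⟨exists_homology_equiv _ _ dB _ hpd2 hcycle hlift hker,
    exists_cohomology_equiv _ _ dB _ hpd2 hcycle hlift hker⟩

end FiberBundle
end

section
/- (Künneth formula for balanced products) Let H be a finite abelian group of odd order and R = F₂[H]. Let C and D be non-negatively graded chain complexes of R-modules that are finite-dimensional over F₂ in each degree and vanish in all but finitely many degrees. Define the balanced product complex C ⊗_R D by (C ⊗_R D)_n = ⊕_{p+q=n} C_p ⊗_R D_q with differential ∂(c ⊗ d) = ∂c ⊗ d + c ⊗ ∂d. Then for every n there is an isomorphism of F₂-vector spaces H_n(C ⊗_R D) ≅ ⊕_{p+q=n} H_p(C) ⊗_R H_q(D). -/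
open scoped TensorProduct

section

variable {R : Type} [CommRing R]

/-- Transport a graded module along an equality of indices. -/
def castDeg {E : ℕ → Type} [∀ n, AddCommGroup (E n)] [∀ n, Module R (E n)]
    {a b : ℕ} (h : a = b) : E a →ₗ[R] E b := by subst h; exact LinearMap.id

variable {C D : ℕ → Type}
  [∀ n, AddCommGroup (C n)] [∀ n, Module R (C n)]
  [∀ n, AddCommGroup (D n)] [∀ n, Module R (D n)]

/-- The differential of the (balanced) tensor product complex
`(C ⊗_R D)_n = ⊕_{p+q=n} C_p ⊗_R D_q`, `∂(c ⊗ d) = ∂c ⊗ d + c ⊗ ∂d`,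
into degree `n`. -/
noncomputable def totIn (dC : ∀ n, C (n + 1) →ₗ[R] C n) (dD : ∀ n, D (n + 1) →ₗ[R] D n)
    (n : ℕ) :
    ((p : Fin (n + 2)) → (C p ⊗[R] D (n + 1 - p))) →ₗ[R]
      ((p : Fin (n + 1)) → (C p ⊗[R] D (n - p))) :=
  LinearMap.pi fun p =>
    (TensorProduct.map (dC p) (castDeg (by omega : n + 1 - ((p : ℕ) + 1) = n - p))).comp
        (LinearMap.proj (⟨(p : ℕ) + 1, by have := p.isLt; omega⟩ : Fin (n + 2)))
      +
      (TensorProduct.map LinearMap.id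
          ((dD (n - p)).comp
            (castDeg (by have := p.isLt; omega : n + 1 - (p : ℕ) = (n - p) + 1)))).comp
        (LinearMap.proj (⟨(p : ℕ), by have := p.isLt; omega⟩ : Fin (n + 2)))

/-- The differential of the (balanced) tensor product complex out of degree `n`. -/
noncomputable def totOut (dC : ∀ n, C (n + 1) →ₗ[R] C n) (dD : ∀ n, D (n + 1) →ₗ[R] D n)
    (n : ℕ) :
    ((p : Fin (n + 1)) → (C p ⊗[R] D (n - p))) →ₗ[R]
      ((p : Fin n) → (C p ⊗[R] D (n - 1 - p))) :=
  LinearMap.pi fun p =>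
    (TensorProduct.map (dC p)
        (castDeg (by have := p.isLt; omega : n - ((p : ℕ) + 1) = n - 1 - p))).comp
        (LinearMap.proj (⟨(p : ℕ) + 1, by have := p.isLt; omega⟩ : Fin (n + 1)))
      +
      (TensorProduct.map LinearMap.id
          ((dD (n - 1 - p)).comp
            (castDeg (by have := p.isLt; omega : n - (p : ℕ) = (n - 1 - p) + 1)))).comp
        (LinearMap.proj (⟨(p : ℕ), by have := p.isLt; omega⟩ : Fin (n + 1)))

/-- The differential of a non-negatively graded complex out of degree `p`
(trivial for `p = 0`). -/
noncomputable def gradedOut {E : ℕ → Type} [∀ n, AddCommGroup (E n)] [∀ n, Module R (E n)]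
    (dE : ∀ n, E (n + 1) →ₗ[R] E n) (p : ℕ) :
    E p →ₗ[R] ((_ : Fin (min p 1)) → E (p - 1)) :=
  LinearMap.pi fun i =>
    (dE (p - 1)).comp (castDeg (by have := i.isLt; omega : p = (p - 1) + 1))

/-- Homology of a non-negatively graded complex at degree `p`. -/
abbrev gradedHomology {E : ℕ → Type} [∀ n, AddCommGroup (E n)] [∀ n, Module R (E n)]
    (dE : ∀ n, E (n + 1) →ₗ[R] E n) (p : ℕ) : Type :=
  ↥(LinearMap.ker (gradedOut dE p)) ⧸
    (LinearMap.range (dE p)).comap (LinearMap.ker (gradedOut dE p)).subtype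

/-- Homology of the (balanced) tensor product complex at degree `n`. -/
abbrev totHomology (dC : ∀ n, C (n + 1) →ₗ[R] C n) (dD : ∀ n, D (n + 1) →ₗ[R] D n)
    (n : ℕ) : Type :=
  ↥(LinearMap.ker (totOut dC dD n)) ⧸
    (LinearMap.range (totIn dC dD n)).comap (LinearMap.ker (totOut dC dD n)).subtype

end

/-- A contraction of the graded complex `E` onto a graded module `H`: inclusion and projection
maps that are chain maps for the zero differential on `H`, and a homotopy from the identity to
their composite. -/
structure HomologyContraction {R : Type} [CommRing R] {E : ℕ → Type}
    [∀ n, AddCommGroup (E n)] [∀ n, Module R (E n)] (dE : ∀ n, E (n + 1) →ₗ[R] E n)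
    (H : ℕ → Type) [∀ n, AddCommGroup (H n)] [∀ n, Module R (H n)] where
  /-- The inclusion of `H` into the complex. -/
  incl : ∀ n, H n →ₗ[R] E n
  /-- The projection of the complex onto `H`. -/
  proj : ∀ n, E n →ₗ[R] H n
  /-- The homotopy. -/
  htpy : ∀ n, E n →ₗ[R] E (n + 1)
  proj_incl : ∀ n, proj n ∘ₗ incl n = LinearMap.id
  d_incl : ∀ n, dE n ∘ₗ incl (n + 1) = 0
  proj_d : ∀ n, proj n ∘ₗ dE n = 0
  homotopy_zero : incl 0 ∘ₗ proj 0 + dE 0 ∘ₗ htpy 0 = LinearMap.id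
  homotopy_succ : ∀ n, incl (n + 1) ∘ₗ proj (n + 1) + dE (n + 1) ∘ₗ htpy (n + 1) +
    htpy n ∘ₗ dE n = LinearMap.id

section Graded

variable {R : Type} [CommRing R] {E : ℕ → Type} [∀ n, AddCommGroup (E n)] [∀ n, Module R (E n)]
  (dE : ∀ n, E (n + 1) →ₗ[R] E n)

theorem castDeg_rfl (a : ℕ) : castDeg (R := R) (E := E) (rfl : a = a) = LinearMap.id := rfl

theorem mem_ker_gradedOut_zero (x : E 0) : x ∈ LinearMap.ker (gradedOut dE 0) := by
  rw [LinearMap.mem_ker]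
  funext i
  exact absurd i.isLt (by simp)

theorem mem_ker_gradedOut_succ {n : ℕ} {x : E (n + 1)} :
    x ∈ LinearMap.ker (gradedOut dE (n + 1)) ↔ dE n x = 0 := by
  rw [LinearMap.mem_ker]
  constructor
  · intro h
    exact congrFun h ⟨0, by simp⟩
  · intro h
    funext i
    exact h

theorem d_mem_ker_gradedOut (hd : ∀ n, dE n ∘ₗ dE (n + 1) = 0) (n : ℕ) (x : E (n + 1)) :
    dE n x ∈ LinearMap.ker (gradedOut dE n) := by
  cases n with
  | zero => exact mem_ker_gradedOut_zero dE _
  | succ n => exact (mem_ker_gradedOut_succ dE).2 (LinearMap.congr_fun (hd n) x)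

/-- Over a semisimple ring every complex contracts onto its homology. -/
theorem nonempty_homologyContraction [IsSemisimpleRing R]
    (hd : ∀ n, dE n ∘ₗ dE (n + 1) = 0) :
    Nonempty (HomologyContraction dE (gradedHomology dE)) := by
  have hr : ∀ n, ∃ r : E n →ₗ[R] LinearMap.ker (gradedOut dE n),
      r ∘ₗ (LinearMap.ker (gradedOut dE n)).subtype = LinearMap.id := fun n =>
    IsSemisimpleModule.extension_property _ (Submodule.injective_subtype _) _
  choose r hr using hr
  have hs : ∀ n, ∃ s : gradedHomology dE n →ₗ[R] LinearMap.ker (gradedOut dE n),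
      Submodule.mkQ _ ∘ₗ s = LinearMap.id := fun n =>
    IsSemisimpleModule.lifting_property _ (Submodule.mkQ_surjective _) _
  choose s hs using hs
  have hσ : ∀ n, ∃ σ : E n →ₗ[R] E (n + 1), ∀ x, dE n (σ (dE n x)) = dE n x := fun n => by
    obtain ⟨τ, hτ⟩ := IsSemisimpleModule.lifting_property (dE n).rangeRestrict
      (LinearMap.surjective_rangeRestrict _) LinearMap.id
    obtain ⟨σ, hσ⟩ := IsSemisimpleModule.extension_property _
      (Submodule.injective_subtype (LinearMap.range (dE n))) τ
    refine ⟨σ, fun x => ?_⟩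
    have h1 := LinearMap.congr_fun hσ ((dE n).rangeRestrict x)
    have h2 := congrArg Subtype.val (LinearMap.congr_fun hτ ((dE n).rangeRestrict x))
    simp only [LinearMap.comp_apply] at h1
    change dE n (σ ((LinearMap.range (dE n)).subtype ((dE n).rangeRestrict x))) = _
    rw [h1]
    exact h2
  choose σ hσ using hσ
  have hr' : ∀ n x (hx : x ∈ LinearMap.ker (gradedOut dE n)), r n x = ⟨x, hx⟩ := fun n x hx =>
    LinearMap.congr_fun (hr n) ⟨x, hx⟩
  have hdr : ∀ n x, dE n (r (n + 1) x) = 0 := fun n x =>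
    (mem_ker_gradedOut_succ dE).1 (r (n + 1) x).2
  let incl : ∀ n, gradedHomology dE n →ₗ[R] E n := fun n => Submodule.subtype _ ∘ₗ s n
  let proj : ∀ n, E n →ₗ[R] gradedHomology dE n := fun n => Submodule.mkQ _ ∘ₗ r n
  let htpy : ∀ n, E n →ₗ[R] E (n + 1) := fun n =>
    (LinearMap.id - Submodule.subtype _ ∘ₗ r (n + 1)) ∘ₗ σ n ∘ₗ
      (Submodule.subtype _ ∘ₗ r n - incl n ∘ₗ proj n)
  have hpi : ∀ n, proj n ∘ₗ incl n = LinearMap.id := fun n => by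
    refine LinearMap.ext fun x => ?_
    change Submodule.mkQ _ (r n (s n _)) = _
    rw [hr' n _ (s n _).2]
    exact LinearMap.congr_fun (hs n) _
  have hpd : ∀ n x, proj n (dE n x) = 0 := fun n x => by
    change Submodule.mkQ _ (r n _) = 0
    rw [hr' n _ (d_mem_ker_gradedOut dE hd n x), Submodule.mkQ_apply,
      Submodule.Quotient.mk_eq_zero]
    exact ⟨x, rfl⟩
  have hdh : ∀ n x, incl n (proj n x) + dE n (htpy n x) = r n x := fun n x => by
    have hb : ((r n x : E n) - incl n (proj n x)) ∈ LinearMap.range (dE n) := by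
      have h : Submodule.mkQ ((LinearMap.range (dE n)).comap
          (LinearMap.ker (gradedOut dE n)).subtype) (r n x - s n (proj n x)) = 0 := by
        rw [map_sub, sub_eq_zero]
        exact (LinearMap.congr_fun (hs n) (proj n x)).symm
      rw [Submodule.mkQ_apply, Submodule.Quotient.mk_eq_zero] at h
      exact h
    obtain ⟨y, hy⟩ := hb
    change _ + dE n (σ n ((r n x : E n) - incl n (proj n x)) -
      (r (n + 1) (σ n ((r n x : E n) - incl n (proj n x))) : E (n + 1))) = _
    rw [map_sub, hdr, ← hy, hσ, hy]
    abel
  refine ⟨⟨incl, proj, htpy, hpi, fun n => ?_, fun n => LinearMap.ext (hpd n), ?_, fun n => ?_⟩⟩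
  · exact LinearMap.ext fun x => (mem_ker_gradedOut_succ dE).1 (s (n + 1) x).2
  · ext1 x
    refine (hdh 0 x).trans ?_
    rw [hr' 0 x (mem_ker_gradedOut_zero dE x)]
    rfl
  · ext1 x
    have hk : σ n (dE n x) - x ∈ LinearMap.ker (gradedOut dE (n + 1)) := by
      rw [mem_ker_gradedOut_succ, map_sub, hσ, sub_self]
    have h1 := congrArg Subtype.val (hr' (n + 1) _ hk)
    rw [map_sub, AddSubgroupClass.coe_sub] at h1
    change _ = σ n (dE n x) - x at h1
    have h2 : htpy n (dE n x) = σ n (dE n x) - (r (n + 1) (σ n (dE n x)) : E (n + 1)) := by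
      change σ n ((r n (dE n x) : E n) - incl n (proj n (dE n x))) -
        (r (n + 1) (σ n ((r n (dE n x) : E n) - incl n (proj n (dE n x)))) : E (n + 1)) = _
      rw [hpd, map_zero, sub_zero, hr' n _ (d_mem_ker_gradedOut dE hd n x)]
    change incl (n + 1) (proj (n + 1) x) + dE (n + 1) (htpy (n + 1) x) + htpy n (dE n x) = x
    rw [hdh, h2]
    linear_combination (norm := abel) -h1

end Graded

section Total

variable {R : Type} [CommRing R] {C D : ℕ → Type}
  [∀ n, AddCommGroup (C n)] [∀ n, Module R (C n)]
  [∀ n, AddCommGroup (D n)] [∀ n, Module R (D n)]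
  (dC : ∀ n, C (n + 1) →ₗ[R] C n) (dD : ∀ n, D (n + 1) →ₗ[R] D n)

/-- The total differential on bigraded families of tensors. -/
noncomputable def bigradedD (f : ∀ p q, C p ⊗[R] D q) (p q : ℕ) : C p ⊗[R] D q :=
  TensorProduct.map (dC p) LinearMap.id (f (p + 1) q) +
    TensorProduct.map LinearMap.id (dD q) (f p (q + 1))

theorem map_castDeg_right {M : ℕ → Type} [∀ n, AddCommGroup (M n)] [∀ n, Module R (M n)]
    {A B : Type} [AddCommGroup A] [Module R A] [AddCommGroup B] [Module R B]
    (g : A →ₗ[R] B) (f : ∀ q, A ⊗[R] M q) {a b : ℕ} (h : a = b) :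
    TensorProduct.map g (castDeg h) (f a) = TensorProduct.map g LinearMap.id (f b) := by
  subst h
  rfl

theorem map_comp_castDeg_right {M : ℕ → Type} [∀ n, AddCommGroup (M n)] [∀ n, Module R (M n)]
    {A B N : Type} [AddCommGroup A] [Module R A] [AddCommGroup B] [Module R B]
    [AddCommGroup N] [Module R N] (g : A →ₗ[R] B) (f : ∀ q, A ⊗[R] M q) {a b : ℕ} (h : a = b)
    (k : M b →ₗ[R] N) :
    TensorProduct.map g (k ∘ₗ castDeg h) (f a) = TensorProduct.map g k (f b) := by
  subst h
  rfl

theorem totIn_apply_bigraded (n : ℕ) (f : ∀ p q, C p ⊗[R] D q) (p : Fin (n + 1)) :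
    totIn dC dD n (fun p => f p (n + 1 - p)) p = bigradedD dC dD f p (n - p) := by
  have h1 := map_castDeg_right (dC p) (f (p + 1))
    (by omega : n + 1 - ((p : ℕ) + 1) = n - p)
  have h2 := map_comp_castDeg_right LinearMap.id (f p)
    (by have := p.isLt; omega : n + 1 - (p : ℕ) = (n - p) + 1) (dD (n - p))
  exact congrArg₂ (· + ·) h1 h2

theorem totOut_succ (n : ℕ) : totOut dC dD (n + 1) = totIn dC dD n := rfl

/-- Every element of the total complex is the restriction of a bigraded family. -/
theorem exists_bigraded_eq (n : ℕ) (z : (p : Fin (n + 1)) → (C p ⊗[R] D (n - p))) :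
    ∃ f : ∀ p q, C p ⊗[R] D q, (fun p : Fin (n + 1) => f p (n - p)) = z := by
  refine ⟨fun p q => if h : p + q = n then
    TensorProduct.map LinearMap.id (castDeg (by omega : n - p = q))
      (z ⟨p, by omega⟩) else 0, ?_⟩
  funext p
  have hp : (p : ℕ) + (n - p) = n := by have := p.isLt; omega
  refine (dif_pos hp).trans ?_
  rw [castDeg_rfl, TensorProduct.map_id]
  rfl

variable {dC dD} {HC HD : ℕ → Type}
  [∀ n, AddCommGroup (HC n)] [∀ n, Module R (HC n)]
  [∀ n, AddCommGroup (HD n)] [∀ n, Module R (HD n)]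
  (cC : HomologyContraction dC HC) (cD : HomologyContraction dD HD)

/-- The part of the contracting homotopy of a tensor product acting on the left factor. -/
noncomputable def bigradedHtpyLeft (f : ∀ p q, C p ⊗[R] D q) : ∀ p q, C p ⊗[R] D q
  | 0, _ => 0
  | p + 1, q => TensorProduct.map (cC.htpy p) LinearMap.id (f p q)

/-- The part of the contracting homotopy of a tensor product acting on the right factor. -/
noncomputable def bigradedHtpyRight (f : ∀ p q, C p ⊗[R] D q) : ∀ p q, C p ⊗[R] D q
  | _, 0 => 0
  | p, q + 1 => TensorProduct.map (cC.incl p ∘ₗ cC.proj p) (cD.htpy q) (f p q)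

/-- The contracting homotopy on bigraded families of tensors. -/
noncomputable def bigradedHtpy (f : ∀ p q, C p ⊗[R] D q) (p q : ℕ) : C p ⊗[R] D q :=
  bigradedHtpyLeft cC f p q + bigradedHtpyRight cC cD f p q

theorem bigradedHtpy_eq_zero {n p q : ℕ} (hpq : p + q = n + 1) (f : ∀ p q, C p ⊗[R] D q)
    (hf : ∀ p q, p + q = n → f p q = 0) : bigradedHtpy cC cD f p q = 0 := by
  have h1 : bigradedHtpyLeft cC f p q = 0 := by
    cases p with
    | zero => rfl
    | succ p => rw [bigradedHtpyLeft, hf p q (by omega), map_zero]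
  have h2 : bigradedHtpyRight cC cD f p q = 0 := by
    cases q with
    | zero => rfl
    | succ q => rw [bigradedHtpyRight, hf p q (by omega), map_zero]
  rw [bigradedHtpy, h1, h2, add_zero]

/-- In characteristic two, `bigradedHtpy` is a homotopy from the identity to the projection. -/
theorem bigraded_homotopy [CharP R 2] (f : ∀ p q, C p ⊗[R] D q) (p q : ℕ) :
    f p q = TensorProduct.map (cC.incl p ∘ₗ cC.proj p) (cD.incl q ∘ₗ cD.proj q) (f p q) +
      bigradedD dC dD (bigradedHtpy cC cD f) p q +
      bigradedHtpy cC cD (bigradedD dC dD f) p q := by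
  have two : ∀ {M : Type} [AddCommGroup M] [Module R M] (x : M), x + x = 0 := fun x => by
    rw [← two_smul R x, CharTwo.two_eq_zero, zero_smul]
  have hdi : ∀ n, dC n ∘ₗ cC.incl (n + 1) ∘ₗ cC.proj (n + 1) = 0 := fun n => by
    rw [← LinearMap.comp_assoc, cC.d_incl, LinearMap.zero_comp]
  have hid : ∀ n, (cC.incl n ∘ₗ cC.proj n) ∘ₗ dC n = 0 := fun n => by
    rw [LinearMap.comp_assoc, cC.proj_d, LinearMap.comp_zero]
  have left : ∀ x : C p ⊗[R] D q,
      TensorProduct.map (cC.incl p ∘ₗ cC.proj p) LinearMap.id x =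
      TensorProduct.map (cC.incl p ∘ₗ cC.proj p) (cD.incl q ∘ₗ cD.proj q) x +
      TensorProduct.map (cC.incl p ∘ₗ cC.proj p) (dD q ∘ₗ cD.htpy q) x +
      (match q, x with
        | 0, _ => 0
        | q + 1, x => TensorProduct.map (cC.incl p ∘ₗ cC.proj p) (cD.htpy q ∘ₗ dD q) x) := by
    intro x
    cases q with
    | zero => rw [add_zero, ← LinearMap.add_apply, ← TensorProduct.map_add_right, cD.homotopy_zero]
    | succ q => rw [← LinearMap.add_apply, ← TensorProduct.map_add_right, ← LinearMap.add_apply,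
        ← TensorProduct.map_add_right, cD.homotopy_succ]
  have right : ∀ x : C p ⊗[R] D q,
      x = TensorProduct.map (cC.incl p ∘ₗ cC.proj p) LinearMap.id x +
      TensorProduct.map (dC p ∘ₗ cC.htpy p) LinearMap.id x +
      (match p, x with
        | 0, _ => 0
        | p + 1, x => TensorProduct.map (cC.htpy p ∘ₗ dC p) LinearMap.id x) := by
    intro x
    cases p with
    | zero => rw [add_zero, ← LinearMap.add_apply, ← TensorProduct.map_add_left, cC.homotopy_zero,
        TensorProduct.map_id, LinearMap.id_apply]
    | succ p => rw [← LinearMap.add_apply, ← TensorProduct.map_add_left, ← LinearMap.add_apply,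
        ← TensorProduct.map_add_left, cC.homotopy_succ, TensorProduct.map_id, LinearMap.id_apply]
  conv_lhs => rw [right (f p q), left (f p q)]
  cases p <;> cases q <;>
    simp only [bigradedD, bigradedHtpy, bigradedHtpyLeft, bigradedHtpyRight, map_add,
      ← LinearMap.comp_apply, ← TensorProduct.map_comp, LinearMap.id_comp, LinearMap.comp_id,
      hdi, hid, TensorProduct.map_zero_left, LinearMap.zero_apply, add_zero, zero_add]
  · abel
  · abel
  · rename_i p
    linear_combination (norm := abel) -two (TensorProduct.map (cC.htpy p) (dD 0) (f p (0 + 1)))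
  · rename_i p q
    linear_combination (norm := abel)
      -two (TensorProduct.map (cC.htpy p) (dD (q + 1)) (f p (q + 1 + 1)))

theorem map_totIn_eq_zero (n : ℕ) (z : (p : Fin (n + 2)) → (C p ⊗[R] D (n + 1 - p)))
    (p : Fin (n + 1)) :
    TensorProduct.map (cC.proj p) (cD.proj (n - p)) (totIn dC dD n z p) = 0 := by
  obtain ⟨f, rfl⟩ := exists_bigraded_eq (n + 1) z
  rw [totIn_apply_bigraded, bigradedD, map_add, ← LinearMap.comp_apply,
    ← TensorProduct.map_comp, ← LinearMap.comp_apply, ← TensorProduct.map_comp, cC.proj_d,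
    cD.proj_d, TensorProduct.map_zero_left, TensorProduct.map_zero_right, LinearMap.zero_apply,
    LinearMap.zero_apply, add_zero]

theorem map_incl_mem_ker_totOut (n : ℕ) (w : (p : Fin (n + 1)) → (HC p ⊗[R] HD (n - p))) :
    (fun p : Fin (n + 1) => TensorProduct.map (cC.incl p) (cD.incl (n - p)) (w p)) ∈
      LinearMap.ker (totOut dC dD n) := by
  rw [LinearMap.mem_ker]
  cases n with
  | zero => exact funext fun p => p.elim0
  | succ n =>
    obtain ⟨g, rfl⟩ := exists_bigraded_eq (n + 1) w
    funext p
    rw [totOut_succ]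
    refine (totIn_apply_bigraded dC dD n
      (fun p q => TensorProduct.map (cC.incl p) (cD.incl q) (g p q)) p).trans ?_
    rw [bigradedD, ← LinearMap.comp_apply, ← TensorProduct.map_comp, ← LinearMap.comp_apply,
      ← TensorProduct.map_comp, cC.d_incl, cD.d_incl, TensorProduct.map_zero_left,
      TensorProduct.map_zero_right, LinearMap.zero_apply, LinearMap.zero_apply, add_zero]
    rfl

/-- A cycle of the total complex with vanishing projection is a boundary. -/
theorem mem_range_totIn [CharP R 2] (n : ℕ) (z : (p : Fin (n + 1)) → (C p ⊗[R] D (n - p)))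
    (hz : z ∈ LinearMap.ker (totOut dC dD n))
    (h : ∀ p : Fin (n + 1), TensorProduct.map (cC.proj p) (cD.proj (n - p)) (z p) = 0) :
    z ∈ LinearMap.range (totIn dC dD n) := by
  obtain ⟨f, rfl⟩ := exists_bigraded_eq n z
  refine ⟨fun p => bigradedHtpy cC cD f p (n + 1 - p), funext fun p => ?_⟩
  rw [totIn_apply_bigraded]
  have hK : bigradedHtpy cC cD (bigradedD dC dD f) p (n - p) = 0 := by
    cases n with
    | zero =>
      obtain rfl : p = 0 := Fin.fin_one_eq_zero p
      exact add_zero _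
    | succ n =>
      refine bigradedHtpy_eq_zero cC cD (n := n) (by have := p.isLt; omega) _ ?_
      rintro a b rfl
      have h1 : bigradedD dC dD f a (a + b - a) = 0 :=
        (totIn_apply_bigraded dC dD (a + b) f ⟨a, by omega⟩).symm.trans
          (congrFun (LinearMap.mem_ker.1 hz) ⟨a, by omega⟩)
      rwa [Nat.add_sub_cancel_left] at h1
  have key := bigraded_homotopy cC cD f p (n - p)
  rw [hK, add_zero, TensorProduct.map_comp, LinearMap.comp_apply, h p, map_zero, zero_add] at key
  exact key.symm

/-- Künneth formula for complexes that contract onto graded modules, in characteristic two. -/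
theorem nonempty_totHomology_equiv [CharP R 2] (cC : HomologyContraction dC HC)
    (cD : HomologyContraction dD HD) (n : ℕ) :
    Nonempty (totHomology dC dD n ≃ₗ[R] ((p : Fin (n + 1)) → (HC p ⊗[R] HD (n - p)))) := by
  let Φ : LinearMap.ker (totOut dC dD n) →ₗ[R] ((p : Fin (n + 1)) → (HC p ⊗[R] HD (n - p))) :=
    (LinearMap.pi fun p => TensorProduct.map (cC.proj p) (cD.proj (n - p)) ∘ₗ
      LinearMap.proj p) ∘ₗ Submodule.subtype _
  have hker : (LinearMap.range (totIn dC dD n)).comap (LinearMap.ker (totOut dC dD n)).subtype =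
      LinearMap.ker Φ := by
    ext z
    constructor
    · rintro ⟨w, hw⟩
      refine LinearMap.mem_ker.2 (funext fun p => ?_)
      change TensorProduct.map (cC.proj p) (cD.proj (n - p)) ((Submodule.subtype _ z) p) = 0
      rw [← hw]
      exact map_totIn_eq_zero cC cD n w p
    · intro hz
      exact mem_range_totIn cC cD n z z.2 fun p => congrFun (LinearMap.mem_ker.1 hz) p
  have hsurj : Function.Surjective Φ := fun w => by
    refine ⟨⟨_, map_incl_mem_ker_totOut cC cD n w⟩, funext fun p => ?_⟩
    change TensorProduct.map (cC.proj p) (cD.proj (n - p))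
      (TensorProduct.map (cC.incl p) (cD.incl (n - p)) (w p)) = w p
    rw [← LinearMap.comp_apply, ← TensorProduct.map_comp, cC.proj_incl, cD.proj_incl,
      TensorProduct.map_id, LinearMap.id_apply]
  exact ⟨(Submodule.quotEquivOfEq _ _ hker).trans (Φ.quotKerEquivOfSurjective hsurj)⟩

end Total

/-- Künneth formula for balanced products: for a finite abelian group `G` of odd order,
`R = F₂[G]`, and non-negatively graded chain complexes `C`, `D` of `R`-modules which are
finite-dimensional over `F₂` in each degree and vanish in all but finitely many degrees,
`H_n(C ⊗_R D) ≅ ⊕_{p+q=n} H_p(C) ⊗_R H_q(D)` as `F₂`-vector spaces for every `n`. -/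
theorem kuenneth_balanced_product
    {G : Type} [CommGroup G] [Fintype G] (hodd : Odd (Fintype.card G))
    {C D : ℕ → Type}
    [∀ n, AddCommGroup (C n)] [∀ n, Module (MonoidAlgebra (ZMod 2) G) (C n)]
    [∀ n, AddCommGroup (D n)] [∀ n, Module (MonoidAlgebra (ZMod 2) G) (D n)]
    [∀ n, Module (ZMod 2) (C n)] [∀ n, Module (ZMod 2) (D n)]
    [∀ n, IsScalarTower (ZMod 2) (MonoidAlgebra (ZMod 2) G) (C n)]
    [∀ n, IsScalarTower (ZMod 2) (MonoidAlgebra (ZMod 2) G) (D n)]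
    [∀ n, FiniteDimensional (ZMod 2) (C n)] [∀ n, FiniteDimensional (ZMod 2) (D n)]
    (dC : ∀ n, C (n + 1) →ₗ[MonoidAlgebra (ZMod 2) G] C n)
    (dD : ∀ n, D (n + 1) →ₗ[MonoidAlgebra (ZMod 2) G] D n)
    (hdC : ∀ n, (dC n).comp (dC (n + 1)) = 0)
    (hdD : ∀ n, (dD n).comp (dD (n + 1)) = 0)
    (hCbdd : ∃ N, ∀ n, N ≤ n → ∀ x : C n, x = 0)
    (hDbdd : ∃ N, ∀ n, N ≤ n → ∀ x : D n, x = 0) :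
    ∀ n : ℕ,
      Nonempty (totHomology dC dD n ≃ₗ[ZMod 2]
        ((p : Fin (n + 1)) →
          (gradedHomology dC (p : ℕ) ⊗[MonoidAlgebra (ZMod 2) G]
            gradedHomology dD (n - (p : ℕ))))) := by
  have hcard : ((Nat.card G : ℕ) : ZMod 2) ≠ 0 := by
    rw [Nat.card_eq_fintype_card, Ne, ZMod.natCast_eq_zero_iff_even, Nat.not_even_iff_odd]
    exact hodd
  have : NeZero ((Nat.card G : ℕ) : ZMod 2) := ⟨hcard⟩
  have : CharP (MonoidAlgebra (ZMod 2) G) 2 := charP_of_injective_algebraMap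
    (FaithfulSMul.algebraMap_injective (ZMod 2) (MonoidAlgebra (ZMod 2) G)) 2
  have : IsSemisimpleRing (MonoidAlgebra (ZMod 2) G) :=
    inferInstanceAs (IsSemisimpleModule (MonoidAlgebra (ZMod 2) G) (MonoidAlgebra (ZMod 2) G))
  obtain ⟨cC⟩ := nonempty_homologyContraction dC hdC
  obtain ⟨cD⟩ := nonempty_homologyContraction dD hdD
  intro n
  obtain ⟨e⟩ := nonempty_totHomology_equiv cC cD n
  exact ⟨{ e.toAddEquiv with map_smul' := ZMod.map_smul e.toAddEquiv }⟩
end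

section
/- (Parameters of binary Goppa codes) Let m, t, s be positive integers, let F = F_{2^m} be the field with 2^m elements, let g ∈ F[X] be a squarefree polynomial of degree t, and let γ₁, …, γ_s ∈ F be distinct elements with g(γᵢ) ≠ 0 for all i. Define the binary Goppa code GC(g, {γᵢ}) = { c ∈ F₂^s : g divides Σ_{i=1}^{s} cᵢ · ∏_{j≠i} (X − γⱼ) in F[X] }. Then dim_{F₂} GC(g, {γᵢ}) ≥ s − m·t, and every nonzero codeword c ∈ GC(g, {γᵢ}) has Hamming weight |c| ≥ 2t + 1. -/
open Polynomial

/-- Membership condition for the binary Goppa code `GC(g, {γᵢ})`: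
`g` divides `Σᵢ cᵢ · ∏_{j≠i} (X − γⱼ)` in `F[X]`. -/
def goppaMem {m : ℕ} (g : Polynomial (GaloisField 2 m)) {s : ℕ}
    (γ : Fin s → GaloisField 2 m) (c : Fin s → ZMod 2) : Prop :=
  g ∣ ∑ i : Fin s,
    Polynomial.C (algebraMap (ZMod 2) (GaloisField 2 m) (c i)) *
      ∏ j ∈ Finset.univ.erase i, (Polynomial.X - Polynomial.C (γ j))

/-- Over a perfect field of characteristic two, every derivative is a square. -/
lemma exists_sq_eq_derivative {F : Type*} [Field F] [CharP F 2] [PerfectRing F 2] (f : F[X]) :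
    ∃ h : F[X], derivative f = h ^ 2 := by
  have hd : derivative (derivative f) = 0 := by
    ext n
    rw [coeff_derivative, coeff_derivative, coeff_zero, mul_assoc]
    have h2 : (((n + 1) * (n + 1 + 1) : ℕ) : F) = 0 :=
      (CharP.cast_eq_zero_iff F 2 _).2 (Nat.even_mul_succ_self (n + 1)).two_dvd
    push_cast at h2 ⊢
    linear_combination (f.coeff (n + 1 + 1)) * h2
  exact ⟨_, (expand_contract 2 hd two_ne_zero).symm.trans (polynomial_expand_eq _ 2 _)⟩

/-- In characteristic two, a squarefree divisor of the derivative of a product of distinct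
monic linear factors has degree less than half the number of factors. -/
lemma two_mul_natDegree_lt_card_of_dvd_derivative {F ι : Type*} [Field F] [CharP F 2]
    [PerfectRing F 2] {g : F[X]} (hg : Squarefree g) {γ : ι → F} (hγ : Function.Injective γ)
    {S : Finset ι} (hS : S.Nonempty)
    (hdvd : g ∣ derivative (∏ i ∈ S, (X - C (γ i)))) :
    2 * g.natDegree < S.card := by
  set f := ∏ i ∈ S, (X - C (γ i)) with hf
  have hfdeg : f.natDegree = S.card := natDegree_finsetProd_X_sub_C_eq_card S γ
  have hsep : f.Separable := separable_prod_X_sub_C_iff'.2 fun _ _ _ _ h => hγ h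
  have hpos : f.natDegree ≠ 0 := hfdeg ▸ hS.card_pos.ne'
  have hne : derivative f ≠ 0 := fun h0 => by
    have hu : IsUnit f := by
      have := hsep
      rwa [separable_def, h0, isCoprime_zero_right] at this
    exact hpos (natDegree_eq_zero_of_isUnit hu)
  obtain ⟨h, hh⟩ := exists_sq_eq_derivative f
  have hgh : g ∣ h := (hg.dvd_pow_iff_dvd two_ne_zero).1 (hh ▸ hdvd)
  have h0 : h ≠ 0 := by
    rintro rfl
    exact hne (by simpa using hh)
  have hle := natDegree_le_of_dvd hgh h0
  have hlt := natDegree_derivative_lt hpos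
  rw [hh, natDegree_pow] at hlt
  omega

/-- A polynomial vanishing at none of the `γ i` is coprime to `∏ (X - γ i)`. -/
lemma isCoprime_prod_X_sub_C {F ι : Type*} [Field F] {g : F[X]} {γ : ι → F} (S : Finset ι)
    (hγ : ∀ i ∈ S, g.eval (γ i) ≠ 0) : IsCoprime g (∏ i ∈ S, (X - C (γ i))) :=
  IsCoprime.prod_right fun i hi =>
    (((irreducible_X_sub_C (γ i)).coprime_iff_not_dvd).2
      fun h => hγ i hi (dvd_iff_isRoot.1 h)).symm

/-- The sum defining `goppaMem` is the derivative of the locator polynomial of the support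
times the product of the remaining linear factors. -/
lemma sum_algebraMap_mul_prod_erase {F ι : Type*} [Field F] [Algebra (ZMod 2) F] [Fintype ι]
    [DecidableEq ι] (γ : ι → F) (c : ι → ZMod 2) :
    ∑ i, C (algebraMap (ZMod 2) F (c i)) * ∏ j ∈ Finset.univ.erase i, (X - C (γ j)) =
      derivative (∏ i with c i ≠ 0, (X - C (γ i))) * ∏ i with ¬ c i ≠ 0, (X - C (γ i)) := by
  rw [derivative_prod_finset, Finset.sum_mul, Finset.sum_filter]
  refine Finset.sum_congr rfl fun i _ => ?_
  split_ifs with hi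
  · have hone : c i = 1 := by
      generalize c i = a at hi
      revert a
      decide
    rw [hone, map_one, C_1, one_mul, derivative_X_sub_C, mul_one,
      ← Finset.prod_filter_mul_prod_filter_not (Finset.univ.erase i) (fun j => c j ≠ 0)]
    congr 2
    · ext j; simp [and_comm]
    · ext j
      simp only [Finset.mem_filter, Finset.mem_erase, Finset.mem_univ, true_and, and_true]
      exact ⟨fun h => h.2, fun h => ⟨fun hj => h (hj ▸ hi), h⟩⟩
  · rw [not_ne_iff.1 hi, map_zero, C_0, zero_mul]

/-- The syndrome map, whose kernel is the binary Goppa code. -/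
noncomputable def goppaSyndrome {m : ℕ} (g : Polynomial (GaloisField 2 m)) {s : ℕ}
    (γ : Fin s → GaloisField 2 m) : (Fin s → ZMod 2) →ₗ[ZMod 2] AdjoinRoot g :=
  ∑ i : Fin s, (LinearMap.proj i).smulRight
    (AdjoinRoot.mk g (∏ j ∈ Finset.univ.erase i, (X - C (γ j))))

lemma mem_ker_goppaSyndrome {m : ℕ} (g : Polynomial (GaloisField 2 m)) {s : ℕ}
    (γ : Fin s → GaloisField 2 m) (c : Fin s → ZMod 2) :
    c ∈ LinearMap.ker (goppaSyndrome g γ) ↔ goppaMem g γ c := by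
  rw [goppaMem, ← AdjoinRoot.mk_eq_zero, LinearMap.mem_ker, map_sum]
  simp only [goppaSyndrome, LinearMap.sum_apply, LinearMap.smulRight_apply, LinearMap.proj_apply,
    AdjoinRoot.smul_mk, C_mul', algebraMap_smul]

lemma finrank_adjoinRoot_galoisField {m : ℕ} (hm : m ≠ 0) {g : Polynomial (GaloisField 2 m)}
    (hg : g ≠ 0) : Module.finrank (ZMod 2) (AdjoinRoot g) = m * g.natDegree := by
  rw [← Module.finrank_mul_finrank (ZMod 2) (GaloisField 2 m) (AdjoinRoot g),
    GaloisField.finrank 2 hm, (AdjoinRoot.powerBasis hg).finrank, AdjoinRoot.powerBasis_dim]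

/-- Parameters of binary Goppa codes: `GC(g, {γᵢ})` is an `F₂`-linear code of
dimension at least `s − m·t` in which every nonzero codeword has Hamming
weight at least `2t + 1`. -/
theorem goppa_code_parameters
    (m t s : ℕ) (hm : 0 < m) (ht : 0 < t) (hs : 0 < s)
    (g : Polynomial (GaloisField 2 m)) (hg : Squarefree g) (hdeg : g.natDegree = t)
    (γ : Fin s → GaloisField 2 m) (hγinj : Function.Injective γ)
    (hγ : ∀ i, g.eval (γ i) ≠ 0) :
    ∃ Code : Submodule (ZMod 2) (Fin s → ZMod 2),
      (∀ c : Fin s → ZMod 2, c ∈ Code ↔ goppaMem g γ c) ∧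
      (s : ℤ) - m * t ≤ (Module.finrank (ZMod 2) Code : ℤ) ∧
      (∀ c : Fin s → ZMod 2, goppaMem g γ c → c ≠ 0 → 2 * t + 1 ≤ hammingNorm c) := by
  have hg0 : g ≠ 0 := hg.ne_zero
  refine ⟨LinearMap.ker (goppaSyndrome g γ), mem_ker_goppaSyndrome g γ, ?_, fun c hc hc0 => ?_⟩
  · have : Module.Finite (GaloisField 2 m) (AdjoinRoot g) := (AdjoinRoot.powerBasis hg0).finite
    have : Module.Finite (ZMod 2) (AdjoinRoot g) := .trans (GaloisField 2 m) _
    have hsum := (goppaSyndrome g γ).finrank_range_add_finrank_ker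
    have hle := (LinearMap.range (goppaSyndrome g γ)).finrank_le
    rw [finrank_adjoinRoot_galoisField hm.ne' hg0, hdeg] at hle
    rw [Module.finrank_fin_fun] at hsum
    zify at hsum hle
    linarith
  · rw [goppaMem, sum_algebraMap_mul_prod_erase] at hc
    have hdvd := (isCoprime_prod_X_sub_C _ fun i _ => hγ i).dvd_of_dvd_mul_right hc
    obtain ⟨i, hi⟩ := Function.ne_iff.1 hc0
    have hlt := two_mul_natDegree_lt_card_of_dvd_derivative hg hγinj
      ⟨i, Finset.mem_filter.2 ⟨Finset.mem_univ i, hi⟩⟩ hdvd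
    rw [hdeg] at hlt
    exact hlt
end
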